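/- Let F be a field of characteristic p ≠ 2 and let λ be a partition of n. Then the image of E_{n+1} under the structural algebra map FΣ_{n+1} → End_F(S^λ↑^{Σ_{n+1}}) generates End_{FΣ_{n+1}}(S^λ↑^{Σ_{n+1}}) as an F-algebra, and the image of E_{n−1} under FΣ_{n−1} → End_F(S^λ↓_{Σ_{n−1}}) generates End_{FΣ_{n−1}}(S^λ↓_{Σ_{n−1}}) as an F-algebra. -/

import Mathlib

namespace CarterPayne

open Finset

/-- A partition of `n`, presented by its parts function; rows are indexed from `1`. -/
structure Partition (n : ℕ) where
  parts : ℕ → ℕ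
  parts_zero : parts 0 = 0
  antitone : ∀ ⦃i j : ℕ⦄, 0 < i → i ≤ j → parts j ≤ parts i
  finite_support : (Function.support parts).Finite
  sum_parts : ∑ᶠ i, parts i = n

variable {n : ℕ}

/-- The set of cells `(row, column)` (both 1-indexed) of the Young diagram of `μ`. -/
def Partition.cells (μ : Partition n) : Set (ℕ × ℕ) :=
  {c | 0 < c.1 ∧ 0 < c.2 ∧ c.2 ≤ μ.parts c.1}

/-- A tabloid for the composition `c` of `n`: an assignment of the `n` symbols to rows
(rows indexed from 1), row `i` receiving exactly `c i` symbols. -/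
def Tabloid (n : ℕ) (c : ℕ → ℕ) : Type :=
  {g : Fin n → ℕ // ∀ i, (Finset.univ.filter fun k => g k = i).card = c i}

/-- The permutation module `M^c` over `R`: the free `R`-module on the set of tabloids. -/
abbrev PermMod (R : Type*) [CommRing R] (n : ℕ) (c : ℕ → ℕ) := Tabloid n c →₀ R

/-- The action of a permutation of the symbols on tabloids. -/
def permTabloid (c : ℕ → ℕ) (π : Equiv.Perm (Fin n)) (f : Tabloid n c) : Tabloid n c :=
  ⟨fun k => f.1 (π.symm k), fun i => by
    rw [← f.2 i]
    exact Finset.card_equiv π.symm fun a => by simp⟩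

/-- The `R`-linear action of a permutation of the symbols on `M^c`. -/
noncomputable def permM (R : Type*) [CommRing R] (c : ℕ → ℕ) (π : Equiv.Perm (Fin n)) :
    PermMod R n c →ₗ[R] PermMod R n c :=
  Finsupp.lmapDomain R R (permTabloid c π)

/-- A bijective `μ`-tableau, presented by the placement map which sends each of the
`n` symbols to the cell of the Young diagram containing it. -/
structure Placement (μ : Partition n) where
  pos : Fin n → ℕ × ℕ
  mem : ∀ k, pos k ∈ μ.cells
  inj : Function.Injective pos
  surj : ∀ c ∈ μ.cells, ∃ k, pos k = c

/-- The column stabilizer of a bijective tableau, as a set of permutations of the symbols. -/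
def colStab {μ : Partition n} (T : Placement μ) : Finset (Equiv.Perm (Fin n)) :=
  Finset.univ.filter fun π => ∀ k, (T.pos (π k)).2 = (T.pos k).2

lemma rowFiber_card {μ : Partition n} (T : Placement μ) (i : ℕ) :
    (Finset.univ.filter fun k => (T.pos k).1 = i).card = μ.parts i := by
  classical
  have h : (Finset.univ.filter fun k => (T.pos k).1 = i).card
      = (Finset.Icc 1 (μ.parts i)).card := by
    apply Finset.card_bij (fun k _ => (T.pos k).2)
    · intro a ha
      simp only [Finset.mem_filter, Finset.mem_univ, true_and] at ha
      obtain ⟨h1, h2, h3⟩ := T.mem a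
      exact Finset.mem_Icc.mpr ⟨h2, ha ▸ h3⟩
    · intro a ha b hb hab
      simp only [Finset.mem_filter, Finset.mem_univ, true_and] at ha hb
      exact T.inj (Prod.ext (ha.trans hb.symm) hab)
    · intro j hj
      rw [Finset.mem_Icc] at hj
      have hi0 : 0 < i := by
        rcases Nat.eq_zero_or_pos i with h0 | h0
        · exfalso; rw [h0, μ.parts_zero] at hj; omega
        · exact h0
      obtain ⟨k, hk⟩ := T.surj (i, j) ⟨hi0, hj.1, hj.2⟩
      exact ⟨k, by simp [hk], by simp [hk]⟩
  rw [h, Nat.card_Icc]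
  omega

/-- The row tabloid `{tπ}` associated to the bijective tableau `tπ`. -/
def rowTabloid {μ : Partition n} (T : Placement μ) (π : Equiv.Perm (Fin n)) :
    Tabloid n μ.parts :=
  ⟨fun k => (T.pos (π k)).1, fun i => by
    rw [← rowFiber_card T i]
    exact Finset.card_equiv π fun a => by simp⟩

/-- The polytabloid `e_t` attached to a bijective tableau `t`. -/
noncomputable def polytabloid (R : Type*) [CommRing R] {μ : Partition n} (T : Placement μ) :
    PermMod R n μ.parts :=
  ∑ π ∈ colStab T, ((Equiv.Perm.sign π : ℤ) : R) • Finsupp.single (rowTabloid T π) (1 : R)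

/-- The Specht module `S^μ`, the span in `M^μ` of all polytabloids. -/
noncomputable def Specht (R : Type*) [CommRing R] (μ : Partition n) :
    Submodule R (PermMod R n μ.parts) :=
  Submodule.span R (Set.range fun T : Placement μ => polytabloid R T)

/-- `β` is obtained from the partition `α` of `n` by moving one box from
(the end of) row `a` to (the end of) row `b`; i.e. `β` is a one-box-shift of `α`. -/
structure OneBoxShift {n : ℕ} (α β : Partition n) (a b : ℕ) : Prop where
  a_pos : 0 < a
  a_lt_b : a < b
  rem : α.parts (a + 1) < α.parts a
  add : α.parts b < α.parts (b - 1)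
  at_a : β.parts a = α.parts a - 1
  at_b : β.parts b = α.parts b + 1
  elsewhere : ∀ i, i ≠ a → i ≠ b → β.parts i = α.parts i

/-- The equivalence between `Fin m` and the non-maximal elements of `Fin (m+1)`. -/
def castE (m : ℕ) : Fin m ≃ {i : Fin (m + 1) // (i : ℕ) < m} where
  toFun k := ⟨⟨k.1, Nat.lt_succ_of_lt k.2⟩, k.2⟩
  invFun i := ⟨i.1.1, i.2⟩
  left_inv k := rfl
  right_inv i := rfl

/-- The standard embedding `Σ_m ↪ Σ_{m+1}` (as the stabilizer of the last symbol). -/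
noncomputable def permIncl (m : ℕ) : Equiv.Perm (Fin m) →* Equiv.Perm (Fin (m + 1)) :=
  Equiv.Perm.extendDomainHom (castE m)

/-- The induced module `S^λ↑^{Σ_{m+1}}`, realized as the space of functions
`f : Σ_{m+1} → S^λ` with `f(σh) = h⁻¹ · f(σ)` for all `h ∈ Σ_m`; the group `Σ_{m+1}`
acts by left translation: `(g • f)(σ) = f(g⁻¹σ)`. -/
noncomputable def indSpecht (F : Type*) [Field F] {m : ℕ} (lam : Partition m) :
    Submodule F (Equiv.Perm (Fin (m + 1)) → PermMod F m lam.parts) where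
  carrier := {f | (∀ σ, f σ ∈ Specht F lam) ∧
    ∀ (σ : Equiv.Perm (Fin (m + 1))) (h : Equiv.Perm (Fin m)),
      f (σ * permIncl m h) = permM F lam.parts h⁻¹ (f σ)}
  add_mem' := by
    rintro f g ⟨hf1, hf2⟩ ⟨hg1, hg2⟩
    refine ⟨fun σ => (Specht F lam).add_mem (hf1 σ) (hg1 σ), fun σ h => ?_⟩
    simp only [Pi.add_apply, hf2 σ h, hg2 σ h, map_add]
  zero_mem' := ⟨fun _ => (Specht F lam).zero_mem, fun σ h => by simp⟩
  smul_mem' := by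
    rintro r f ⟨hf1, hf2⟩
    refine ⟨fun σ => (Specht F lam).smul_mem r (hf1 σ), fun σ h => ?_⟩
    simp only [Pi.smul_apply, hf2 σ h, map_smul]

/-- The endomorphism algebra `End_{FΣ_{m+1}}(S^λ↑^{Σ_{m+1}})`: the subalgebra of
`F`-endomorphisms intertwining the translation action of `Σ_{m+1}`. -/
noncomputable def EndInd (F : Type*) [Field F] {m : ℕ} (lam : Partition m) :
    Subalgebra F (Module.End F ↥(indSpecht F lam)) where
  carrier := {Φ | ∀ (g : Equiv.Perm (Fin (m + 1))) (x y : ↥(indSpecht F lam)),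
    (x : Equiv.Perm (Fin (m + 1)) → PermMod F m lam.parts) = (fun σ => (y : _ → _) (g⁻¹ * σ)) →
    (Φ x : Equiv.Perm (Fin (m + 1)) → PermMod F m lam.parts) = fun σ => (Φ y : _ → _) (g⁻¹ * σ)}
  mul_mem' := fun {f g} hf hg gg x y hxy => hf gg (g x) (g y) (hg gg x y hxy)
  one_mem' := fun g x y hxy => hxy
  add_mem' := fun {f g} hf hg gg x y hxy => by
    have h1 := hf gg x y hxy
    have h2 := hg gg x y hxy
    funext σ
    simp only [LinearMap.add_apply, Submodule.coe_add, Pi.add_apply]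
    rw [congrFun h1 σ, congrFun h2 σ]
  zero_mem' := fun g x y hxy => by
    simp only [LinearMap.zero_apply, Submodule.coe_zero]
    rfl
  algebraMap_mem' := fun c g x y hxy => by
    funext σ
    simp only [Module.algebraMap_end_apply, SetLike.val_smul, Pi.smul_apply]
    rw [congrFun hxy σ]

/-- Translation by `g ∈ Σ_{m+1}` as an `F`-endomorphism of the induced module:
`(g • f)(σ) = f(g⁻¹σ)`. -/
noncomputable def indTrans (F : Type*) [Field F] {m : ℕ} (lam : Partition m)
    (g : Equiv.Perm (Fin (m + 1))) : Module.End F ↥(indSpecht F lam) where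
  toFun f := ⟨fun σ => f.1 (g⁻¹ * σ),
    ⟨fun σ => f.2.1 _, fun σ h => by
      have := f.2.2 (g⁻¹ * σ) h
      simpa only [mul_assoc] using this⟩⟩
  map_add' a b := Subtype.ext (funext fun σ => rfl)
  map_smul' r a := Subtype.ext (funext fun σ => rfl)

open Classical in
/-- The image of `E_{m+1}`, the sum of all transpositions of `Σ_{m+1}`, under the
structural map `FΣ_{m+1} → End_F(S^λ↑^{Σ_{m+1}})`. -/
noncomputable def indE (F : Type*) [Field F] {m : ℕ} (lam : Partition m) :
    Module.End F ↥(indSpecht F lam) :=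
  ∑ g ∈ Finset.univ.filter (fun g : Equiv.Perm (Fin (m + 1)) => g.IsSwap), indTrans F lam g

open Classical in
/-- The image of `E_{n-1}`, the sum of all transpositions of `Σ_{n-1} ≤ Σ_n` (those
fixing the last symbol), under the structural map `FΣ_{n-1} → End_F(M^λ)`. -/
noncomputable def resE (F : Type*) [Field F] {n : ℕ} (hn : 0 < n) (lam : Partition n) :
    PermMod F n lam.parts →ₗ[F] PermMod F n lam.parts :=
  ∑ g ∈ Finset.univ.filter (fun g : Equiv.Perm (Fin n) =>
      g.IsSwap ∧ g ⟨n - 1, by omega⟩ = ⟨n - 1, by omega⟩),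
    permM F lam.parts g

/-- The endomorphism algebra `End_{FΣ_{n-1}}(S^λ↓_{Σ_{n-1}})` for `λ` a partition of `n`:
endomorphisms of `S^λ` intertwining the action of every permutation fixing the symbol `e`. -/
noncomputable def EndResAt (F : Type*) [Field F] {n : ℕ} (lam : Partition n) (e : Fin n) :
    Subalgebra F (Module.End F ↥(Specht F lam)) where
  carrier := {Φ | ∀ π : Equiv.Perm (Fin n), π e = e →
    ∀ x y : ↥(Specht F lam),
      (x : PermMod F n lam.parts) = permM F lam.parts π (y : PermMod F n lam.parts) →
      (Φ x : PermMod F n lam.parts) = permM F lam.parts π (Φ y : PermMod F n lam.parts)}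
  mul_mem' := fun {f g} hf hg π hπ x y hxy => hf π hπ (g x) (g y) (hg π hπ x y hxy)
  one_mem' := fun π hπ x y hxy => hxy
  add_mem' := fun {f g} hf hg π hπ x y hxy => by
    simp only [LinearMap.add_apply, Submodule.coe_add, map_add,
      hf π hπ x y hxy, hg π hπ x y hxy]
  zero_mem' := fun π hπ x y hxy => by simp
  algebraMap_mem' := fun c π hπ x y hxy => by
    simp only [Module.algebraMap_end_apply, SetLike.val_smul, map_smul, hxy]

open Finset

set_option linter.unusedSectionVars false

section Core

variable {F : Type*} [Field F] {A : Type*} [Fintype A] [DecidableEq A]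

/-- Functions on words: the ambient space for all our computations. -/
abbrev Wd (F : Type*) (A : Type*) := (A → ℕ) → F

/-- Action of permutations on functions of words. -/
def act (π : Equiv.Perm A) : Wd F A →ₗ[F] Wd F A where
  toFun v g := v (g ∘ π)
  map_add' _ _ := rfl
  map_smul' _ _ := rfl

lemma act_apply (π : Equiv.Perm A) (v : Wd F A) (g : A → ℕ) : act π v g = v (g ∘ π) := rfl

lemma act_mul (π τ : Equiv.Perm A) (v : Wd F A) : act (π * τ) v = act π (act τ v) := rfl

lemma act_one (v : Wd F A) : act 1 v = v := rfl

lemma act_prod (π : Equiv.Perm A) (u v : Wd F A) : act π (u * v) = act π u * act π v := rfl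

/-- The determinant function attached to a column. -/
noncomputable def minor {h : ℕ} (C : Fin h → A) : Wd F A := fun g =>
  Matrix.det (Matrix.of fun i j : Fin h => if g (C i) = (j : ℕ) + 1 then (1 : F) else 0)

lemma act_minor {h : ℕ} (π : Equiv.Perm A) (C : Fin h → A) :
    act π (minor C : Wd F A) = minor (π ∘ C) := rfl

lemma minor_comp_perm {h : ℕ} (C : Fin h → A) (τ : Equiv.Perm (Fin h)) :
    (minor (C ∘ τ) : Wd F A) = ((Equiv.Perm.sign τ : ℤ) : F) • minor C := by
  funext g
  simp only [minor, Pi.smul_apply, smul_eq_mul]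
  rw [← Matrix.det_permute]
  rfl

lemma minor_eq_zero_of_eq {h : ℕ} (C : Fin h → A) {i j : Fin h} (hij : i ≠ j) {g : A → ℕ}
    (hg : g (C i) = g (C j)) : (minor C : Wd F A) g = 0 := by
  refine Matrix.det_zero_of_row_eq hij ?_
  funext k
  simp [hg]

lemma minor_eq_zero_of_range {h : ℕ} (C : Fin h → A) {i : Fin h} {g : A → ℕ}
    (hg : ¬ (1 ≤ g (C i) ∧ g (C i) ≤ h)) : (minor C : Wd F A) g = 0 := by
  refine Matrix.det_eq_zero_of_row_eq_zero i ?_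
  intro k
  have := k.2
  simp only [Matrix.of_apply, ite_eq_right_iff, one_ne_zero, imp_false]
  omega

lemma minor_std {h : ℕ} (C : Fin h → A) {g : A → ℕ}
    (hg : ∀ i, g (C i) = (i : ℕ) + 1) : (minor C : Wd F A) g = 1 := by
  have : (Matrix.of fun i j : Fin h => if g (C i) = (j : ℕ) + 1 then (1 : F) else 0) = 1 := by
    ext i j
    simp [hg, Matrix.one_apply, Fin.ext_iff]
  simp [minor, this]

lemma minor_perm {h : ℕ} (C : Fin h → A) {g : A → ℕ} (τ : Equiv.Perm (Fin h))
    (hg : ∀ i, g (C i) = (τ i : ℕ) + 1) :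
    (minor C : Wd F A) g = ((Equiv.Perm.sign τ : ℤ) : F) := by
  have h1 : (minor (C ∘ ⇑(τ⁻¹ : Equiv.Perm (Fin h))) : Wd F A) g = 1 :=
    minor_std _ (fun i => by simp [hg])
  rw [minor_comp_perm] at h1
  simp only [Equiv.Perm.sign_inv, Pi.smul_apply, smul_eq_mul] at h1
  rcases Int.units_eq_one_or (Equiv.Perm.sign τ) with h | h <;> rw [h] at h1 ⊢ <;> simp at h1 ⊢
  · exact h1
  · linear_combination -h1

/-- Overwrite a word on the column `C` by the standard values. -/
noncomputable def ov {h : ℕ} (C : Fin h → A) (g : A → ℕ) : A → ℕ :=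
  Function.extend C (fun i => (i : ℕ) + 1) g

lemma ov_mem {h : ℕ} {C : Fin h → A} (hC : Function.Injective C) (g : A → ℕ) (i : Fin h) :
    ov C g (C i) = (i : ℕ) + 1 := hC.extend_apply _ _ _

lemma ov_not {h : ℕ} {C : Fin h → A} (g : A → ℕ) {a : A} (ha : ∀ i, C i ≠ a) :
    ov C g a = g a := Function.extend_apply' _ _ _ (by rintro ⟨i, hi⟩; exact ha i hi)

/-- Evaluation on overwritten words. -/
noncomputable def rho {h : ℕ} (C : Fin h → A) : Wd F A →ₗ[F] Wd F A where
  toFun u g := u (ov C g)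
  map_add' _ _ := rfl
  map_smul' _ _ := rfl

lemma rho_apply {h : ℕ} (C : Fin h → A) (u : Wd F A) (g : A → ℕ) : rho C u g = u (ov C g) := rfl

lemma ov_comp {h : ℕ} {C : Fin h → A} (hC : Function.Injective C) (g : A → ℕ)
    (π : Equiv.Perm A) (hπ : ∀ i, π (C i) = C i) : ov C g ∘ π = ov C (g ∘ π) := by
  funext a
  by_cases ha : ∃ i, C i = a
  · obtain ⟨i, rfl⟩ := ha
    simp [hπ, ov_mem hC]
  · push Not at ha
    have h2 : ∀ i, C i ≠ π a := by
      intro i hi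
      apply ha i
      apply π.injective
      rw [hπ, hi]
    simp [ov_not _ ha, ov_not _ h2]

lemma rho_act {h : ℕ} {C : Fin h → A} (hC : Function.Injective C) (u : Wd F A)
    (π : Equiv.Perm A) (hπ : ∀ i, π (C i) = C i) : rho C (act π u) = act π (rho C u) := by
  funext g
  simp only [rho_apply, act_apply, ov_comp hC g π hπ]

/-- Antisymmetry under the symmetric group of a column. -/
def AS {h : ℕ} (C : Fin h → A) (u : Wd F A) : Prop :=
  ∀ i j, i ≠ j → act (Equiv.swap (C i) (C j)) u = -u

lemma comp_swap_of_eq {g : A → ℕ} {a b : A} (hg : g a = g b) : g ∘ Equiv.swap a b = g := by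
  funext x
  simp only [Function.comp_apply, Equiv.swap_apply_def]
  split_ifs with h1 h2
  · rw [h1, hg]
  · rw [h2, hg]
  · rfl

lemma anti_zero (h2 : (2 : F) ≠ 0) {u : Wd F A} {a b : A}
    (hu : act (Equiv.swap a b) u = -u) {g : A → ℕ} (hg : g a = g b) : u g = 0 := by
  have := congrFun hu g
  rw [act_apply, comp_swap_of_eq hg] at this
  simp only [Pi.neg_apply] at this
  have h3 : (2 : F) * u g = 0 := by linear_combination this
  exact (mul_eq_zero.mp h3).resolve_left h2

lemma AS.zero (h2 : (2 : F) ≠ 0) {h : ℕ} {C : Fin h → A} {u : Wd F A} (hu : AS C u)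
    {i j : Fin h} (hij : i ≠ j) {g : A → ℕ} (hg : g (C i) = g (C j)) : u g = 0 :=
  anti_zero h2 (hu i j hij) hg

lemma AS.perm_aux {h : ℕ} {C : Fin h → A} (hC : Function.Injective C) {u : Wd F A} (hu : AS C u)
    (g : A → ℕ) (τ : Equiv.Perm (Fin h)) :
    u (Function.extend C (fun i => (τ i : ℕ) + 1) g)
      = ((Equiv.Perm.sign τ : ℤ) : F) * u (ov C g) := by
  induction τ using Equiv.Perm.swap_induction_on' with
  | one => simp [ov]
  | mul_swap f x y hxy ih =>
    have h1 := congrFun (hu x y hxy) (Function.extend C (fun i => (f i : ℕ) + 1) g)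
    rw [act_apply, Pi.neg_apply, ih] at h1
    have h3 : Function.extend C (fun i => (f i : ℕ) + 1) g ∘ (Equiv.swap (C x) (C y))
        = Function.extend C (fun i => ((f * Equiv.swap x y) i : ℕ) + 1) g := by
      funext a
      by_cases ha : ∃ i, C i = a
      · obtain ⟨i, rfl⟩ := ha
        rw [Function.comp_apply, hC.extend_apply, hC.swap_apply, hC.extend_apply]
        rfl
      · have ha' : ∀ i, a ≠ C i := fun i hi => ha ⟨i, hi.symm⟩
        rw [Function.comp_apply, Equiv.swap_apply_of_ne_of_ne (ha' x) (ha' y),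
          Function.extend_apply' _ _ _ ha, Function.extend_apply' _ _ _ ha]
    rw [h3] at h1
    rw [h1, Equiv.Perm.sign_mul, Equiv.Perm.sign_swap hxy]
    simp

lemma AS.perm {h : ℕ} {C : Fin h → A} (hC : Function.Injective C) {u : Wd F A} (hu : AS C u)
    (g : A → ℕ) (τ : Equiv.Perm (Fin h)) (hg : ∀ i, g (C i) = (τ i : ℕ) + 1) :
    u g = ((Equiv.Perm.sign τ : ℤ) : F) * u (ov C g) := by
  rw [← AS.perm_aux hC hu]
  congr 1
  funext a
  by_cases ha : ∃ i, C i = a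
  · obtain ⟨i, rfl⟩ := ha
    rw [hC.extend_apply, hg]
  · rw [Function.extend_apply' _ _ _ ha]

/-- If `g ∘ C` is injective with values in `1..h`, it is a permutation. -/
lemma exists_perm_of_inj {h : ℕ} {C : Fin h → A} {g : A → ℕ}
    (hinj : ∀ i j, i ≠ j → g (C i) ≠ g (C j)) (hr : ∀ i, 1 ≤ g (C i) ∧ g (C i) ≤ h) :
    ∃ τ : Equiv.Perm (Fin h), ∀ i, g (C i) = (τ i : ℕ) + 1 := by
  let f : Fin h → Fin h := fun i => ⟨g (C i) - 1, by have := hr i; omega⟩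
  have hf : Function.Injective f := by
    intro i j hij
    by_contra hne
    apply hinj i j hne
    have := congrArg Fin.val hij
    simp only [f] at this
    have h1 := hr i
    have h2 := hr j
    omega
  refine ⟨Equiv.ofBijective f (Finite.injective_iff_bijective.mp hf), fun i => ?_⟩
  have := hr i
  simp only [Equiv.ofBijective_apply, f]
  omega

/-- The weight (row lengths) attached to a list of column heights. -/
def wt (hs : List ℕ) (i : ℕ) : ℕ := hs.countP (fun h => decide (1 ≤ i ∧ i ≤ h))

lemma wt_cons (h : ℕ) (hs : List ℕ) (i : ℕ) :
    wt (h :: hs) i = wt hs i + if 1 ≤ i ∧ i ≤ h then 1 else 0 := by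
  simp [wt, List.countP_cons]

lemma wt_eq_zero {hs : List ℕ} {l i : ℕ} (hl : ∀ h ∈ hs, h ≤ l) (hi : ¬ (1 ≤ i ∧ i ≤ l)) :
    wt hs i = 0 := by
  rw [wt, List.countP_eq_zero]
  intro h hh
  have := hl h hh
  simp only [decide_eq_true_eq]
  omega

/-- Functions depending only on `B`, of weight `wt hs`. -/
def Wt (F : Type*) [Field F] (hs : List ℕ) (B : Finset A) : Submodule F (Wd F A) where
  carrier := {v | (∀ g g' : A → ℕ, (∀ a ∈ B, g a = g' a) → v g = v g') ∧
    ∀ g, v g ≠ 0 → ∀ i, (B.filter (fun a => g a = i)).card = wt hs i}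
  add_mem' := by
    rintro u v ⟨h1, h2⟩ ⟨h3, h4⟩
    refine ⟨fun g g' h => by simp [h1 g g' h, h3 g g' h], fun g hg => ?_⟩
    by_cases hu : u g = 0
    · apply h4
      intro hv
      apply hg
      simp [hu, hv]
    · exact h2 g hu
  zero_mem' := ⟨fun _ _ _ => rfl, fun g hg => absurd rfl hg⟩
  smul_mem' := by
    rintro r u ⟨h1, h2⟩
    refine ⟨fun g g' h => by simp [h1 g g' h], fun g hg => h2 g ?_⟩
    intro hv
    apply hg
    simp [hv]

/-- The raising operators on the letters in `B`. -/
def raise (B : Finset A) (q : ℕ) : Wd F A →ₗ[F] Wd F A where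
  toFun v g := ∑ a ∈ B.filter (fun a => g a = q), v (Function.update g a (q + 1))
  map_add' u v := by funext g; simp [Finset.sum_add_distrib]
  map_smul' r v := by funext g; simp [Finset.mul_sum]

lemma raise_apply (B : Finset A) (q : ℕ) (v : Wd F A) (g : A → ℕ) :
    raise B q v g = ∑ a ∈ B.filter (fun a => g a = q), v (Function.update g a (q + 1)) := rfl

/-- The common kernel of the raising operators. -/
def Ker (F : Type*) [Field F] (hs : List ℕ) (B : Finset A) : Submodule F (Wd F A) :=
  Wt F hs B ⊓ ⨅ q : ℕ, ⨅ _ : 1 ≤ q, LinearMap.ker (raise B q)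

lemma mem_Ker {hs : List ℕ} {B : Finset A} {v : Wd F A} :
    v ∈ Ker F hs B ↔ v ∈ Wt F hs B ∧ ∀ q, 1 ≤ q → ∀ g, raise B q v g = 0 := by
  simp only [Ker, Submodule.mem_inf, Submodule.mem_iInf, LinearMap.mem_ker]
  refine and_congr_right fun _ => forall_congr' fun q => forall_congr' fun _ => ?_
  exact funext_iff

lemma Wt.zero_of_range {hs : List ℕ} {B : Finset A} {v : Wd F A} (hv : v ∈ Wt F hs B)
    {l : ℕ} (hl : ∀ h ∈ hs, h ≤ l) {a : A} (ha : a ∈ B) {g : A → ℕ}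
    (hg : ¬ (1 ≤ g a ∧ g a ≤ l)) : v g = 0 := by
  by_contra hne
  have h1 := hv.2 g hne (g a)
  rw [wt_eq_zero hl hg, Finset.card_eq_zero] at h1
  have : a ∈ B.filter (fun b => g b = g a) := by simp [ha]
  rw [h1] at this
  simp at this

/-- Division of an antisymmetric function by the determinant of a longest column. -/
lemma div_minor (h2 : (2 : F) ≠ 0) {h : ℕ} {hs : List ℕ} {B : Finset A} {u : Wd F A}
    (hu : u ∈ Wt F (h :: hs) B) (hle : ∀ k ∈ hs, k ≤ h) {C : Fin h → A}
    (hC : Function.Injective C) (hCB : ∀ i, C i ∈ B) (has : AS C u) :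
    u = minor C * rho C u := by
  funext g
  rw [Pi.mul_apply, rho_apply]
  by_cases hinj : ∀ i j, i ≠ j → g (C i) ≠ g (C j)
  · by_cases hr : ∀ i, 1 ≤ g (C i) ∧ g (C i) ≤ h
    · obtain ⟨τ, hτ⟩ := exists_perm_of_inj hinj hr
      rw [minor_perm C τ hτ, AS.perm hC has g τ hτ]
    · push Not at hr
      obtain ⟨i, hi⟩ := hr
      have hi' : ¬ (1 ≤ g (C i) ∧ g (C i) ≤ h) := by
        rintro ⟨h3, h4⟩
        exact absurd (hi h3) (by omega)
      rw [minor_eq_zero_of_range C hi', zero_mul]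
      exact Wt.zero_of_range hu (l := h) (by simpa using hle) (hCB i) hi'
  · push Not at hinj
    obtain ⟨i, j, hij, hg⟩ := hinj
    rw [minor_eq_zero_of_eq C hij hg, zero_mul, has.zero h2 hij hg]

lemma card_filter_ov {h : ℕ} {C : Fin h → A} (hC : Function.Injective C) {B : Finset A}
    (hd : ∀ i, C i ∉ B) (g : A → ℕ) (i : ℕ) :
    ((B ∪ univ.image C).filter (fun a => ov C g a = i)).card
      = (B.filter (fun a => g a = i)).card + if 1 ≤ i ∧ i ≤ h then 1 else 0 := by
  have hdisj : Disjoint B (univ.image C) := by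
    rw [Finset.disjoint_right]
    intro a ha
    obtain ⟨i, _, rfl⟩ := Finset.mem_image.mp ha
    exact hd i
  rw [Finset.filter_union, Finset.card_union_of_disjoint
    (Finset.disjoint_filter_filter hdisj)]
  congr 1
  · congr 1
    apply Finset.filter_congr
    intro a ha
    rw [ov_not]
    rintro i rfl
    exact hd i ha
  · rw [Finset.filter_image, Finset.card_image_of_injective _ hC]
    simp only [ov_mem hC]
    split_ifs with hi
    · rw [Finset.card_eq_one]
      refine ⟨⟨i - 1, by omega⟩, ?_⟩
      ext k
      simp [Fin.ext_iff]
      omega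
    · rw [Finset.card_eq_zero, Finset.filter_eq_empty_iff]
      intro k _
      have := k.2
      omega

lemma rho_mem_Wt {h : ℕ} {hs : List ℕ} {B : Finset A} {u : Wd F A} {C : Fin h → A}
    (hC : Function.Injective C) (hd : ∀ i, C i ∉ B)
    (hu : u ∈ Wt F (h :: hs) (B ∪ univ.image C)) : rho C u ∈ Wt F hs B := by
  refine ⟨fun g g' hgg => ?_, fun g hg i => ?_⟩
  · rw [rho_apply, rho_apply]
    apply hu.1
    intro a ha
    by_cases hc : ∃ i, C i = a
    · obtain ⟨i, rfl⟩ := hc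
      rw [ov_mem hC, ov_mem hC]
    · push Not at hc
      rw [ov_not _ hc, ov_not _ hc]
      apply hgg
      simp only [Finset.mem_union, Finset.mem_image, Finset.mem_univ, true_and] at ha
      rcases ha with ha | ⟨i, hi⟩
      · exact ha
      · exact absurd hi (hc i)
  · rw [rho_apply] at hg
    have := hu.2 _ hg i
    rw [card_filter_ov hC hd, wt_cons] at this
    omega

lemma ov_update {h : ℕ} {C : Fin h → A} (hC : Function.Injective C) (g : A → ℕ) {a : A}
    (ha : ∀ i, C i ≠ a) (x : ℕ) :
    ov C (Function.update g a x) = Function.update (ov C g) a x := by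
  funext b
  by_cases hc : ∃ i, C i = b
  · obtain ⟨i, rfl⟩ := hc
    rw [ov_mem hC, Function.update_of_ne (ha i), ov_mem hC]
  · push Not at hc
    rw [ov_not _ hc]
    by_cases hb : b = a
    · subst hb; simp
    · rw [Function.update_of_ne hb, Function.update_of_ne hb, ov_not _ hc]

lemma rho_mem_Ker {h : ℕ} {hs : List ℕ} {B : Finset A} {u : Wd F A} {C : Fin h → A}
    (hC : Function.Injective C) (hd : ∀ i, C i ∉ B)
    (hu : u ∈ Ker F (h :: hs) (B ∪ univ.image C)) (hle : ∀ k ∈ hs, k ≤ h)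
    (hz : ∀ (i : Fin h), (i : ℕ) + 1 < h → ∀ g,
      u (Function.update (ov C g) (C i) ((i : ℕ) + 2)) = 0) : rho C u ∈ Ker F hs B := by
  rw [mem_Ker] at hu ⊢
  refine ⟨rho_mem_Wt hC hd hu.1, fun q hq g => ?_⟩
  have h1 := hu.2 q hq (ov C g)
  rw [raise_apply] at h1 ⊢
  have hdisj : Disjoint B (univ.image C) := by
    rw [Finset.disjoint_right]
    intro a ha
    obtain ⟨i, _, rfl⟩ := Finset.mem_image.mp ha
    exact hd i
  rw [Finset.filter_union, Finset.sum_union (Finset.disjoint_filter_filter hdisj)] at h1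
  have h3 : ∑ a ∈ (univ.image C).filter (fun a => ov C g a = q),
      u (Function.update (ov C g) a (q + 1)) = 0 := by
    apply Finset.sum_eq_zero
    intro a ha
    rw [Finset.mem_filter] at ha
    obtain ⟨ha, haq⟩ := ha
    obtain ⟨i, _, rfl⟩ := Finset.mem_image.mp ha
    rw [ov_mem hC] at haq
    subst haq
    by_cases hi : (i : ℕ) + 1 < h
    · exact hz i hi g
    · apply Wt.zero_of_range hu.1 (l := h) (a := C i)
      · simpa using hle
      · simp
      · simp
        omega
  rw [h3, add_zero] at h1
  rw [← h1]
  have hB : ∀ a ∈ B, ∀ i, C i ≠ a := by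
    rintro a ha i rfl
    exact hd i ha
  apply Finset.sum_congr
  · apply Finset.filter_congr
    intro a ha
    rw [ov_not _ (hB a ha)]
  · intro a ha
    rw [rho_apply, ov_update hC _ (hB a (Finset.mem_filter.mp ha).1)]

end Core

open Finset
set_option linter.unusedSectionVars false

section Core

variable {F : Type*} [Field F] {A : Type*} [Fintype A] [DecidableEq A]

/-- Products of determinants: the polytabloids with support `B`. -/
inductive Gen (F : Type*) [Field F] {A : Type*} [Fintype A] [DecidableEq A] :
    List ℕ → Finset A → Wd F A → Prop
  | nil : Gen F [] ∅ 1
  | cons {h : ℕ} {hs : List ℕ} {B B' : Finset A} {p : Wd F A} (C : Fin h → A)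
      (hC : Function.Injective C) (hd : ∀ i, C i ∉ B) (hB : B' = B ∪ univ.image C)
      (hp : Gen F hs B p) : Gen F (h :: hs) B' (minor C * p)

/-- Span of the polytabloids. -/
def Sp (F : Type*) [Field F] (hs : List ℕ) (B : Finset A) : Submodule F (Wd F A) :=
  Submodule.span F {p | Gen F hs B p}

/-- `π` is a permutation of `B`. -/
def Fix (π : Equiv.Perm A) (B : Finset A) : Prop := ∀ a, a ∉ B → π a = a

lemma Fix.mono {π : Equiv.Perm A} {B B' : Finset A} (h : Fix π B) (hB : B ⊆ B') : Fix π B' :=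
  fun a ha => h a (fun h' => ha (hB h'))

lemma Fix.mem {π : Equiv.Perm A} {B : Finset A} (h : Fix π B) {a : A} : π a ∈ B ↔ a ∈ B := by
  constructor
  · intro h1
    by_contra h2
    rw [h a h2] at h1
    exact h2 h1
  · intro h1
    by_contra h2
    have := h _ h2
    rw [π.injective this] at h2
    exact h2 h1

lemma Fix.image {π : Equiv.Perm A} {B : Finset A} (h : Fix π B) : B.image π = B := by
  apply Finset.eq_of_subset_of_card_le
  · intro a ha
    obtain ⟨b, hb, rfl⟩ := Finset.mem_image.mp ha
    exact h.mem.mpr hb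
  · rw [Finset.card_image_of_injective _ π.injective]

lemma Fix.swap {B : Finset A} {a b : A} (ha : a ∈ B) (hb : b ∈ B) : Fix (Equiv.swap a b) B := by
  intro c hc
  apply Equiv.swap_apply_of_ne_of_ne
  · rintro rfl; exact hc ha
  · rintro rfl; exact hc hb

lemma Fix.mul {B : Finset A} {π τ : Equiv.Perm A} (h : Fix π B) (h' : Fix τ B) :
    Fix (π * τ) B := by
  intro a ha
  rw [Equiv.Perm.mul_apply, h' a ha, h a ha]

lemma Fix.inv {B : Finset A} {π : Equiv.Perm A} (h : Fix π B) : Fix π⁻¹ B := by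
  intro a ha
  rw [Equiv.Perm.inv_eq_iff_eq, h a ha]

lemma Gen.act {hs : List ℕ} {B : Finset A} {p : Wd F A} (hp : Gen F hs B p)
    (π : Equiv.Perm A) : Gen F hs (B.image π) (act π p) := by
  induction hp with
  | nil => exact Gen.nil
  | cons C hC hd hB hp ih =>
    subst hB
    rw [act_prod, act_minor]
    refine Gen.cons _ (π.injective.comp hC) ?_ ?_ ih
    · intro i hi
      obtain ⟨a, ha, hai⟩ := Finset.mem_image.mp hi
      rw [Function.comp_apply] at hai
      rw [π.injective hai] at ha
      exact hd i ha
    · rw [Finset.image_union, Finset.image_image]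

lemma Sp_act {hs : List ℕ} {B : Finset A} {v : Wd F A} (hv : v ∈ Sp F hs B)
    {π : Equiv.Perm A} (hπ : Fix π B) : act π v ∈ Sp F hs B := by
  have : Sp F hs B ≤ (Sp F hs B).comap (CarterPayne.act π) := by
    refine Submodule.span_le.mpr fun p hp => ?_
    have := hp.act π
    rw [hπ.image] at this
    exact Submodule.subset_span this
  exact this hv

lemma minor_mul_mem {h : ℕ} {hs : List ℕ} {B : Finset A} {v : Wd F A} {C : Fin h → A}
    (hC : Function.Injective C) (hd : ∀ i, C i ∉ B) (hv : v ∈ Sp F hs B) :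
    minor C * v ∈ Sp F (h :: hs) (B ∪ univ.image C) := by
  have : Sp F hs B ≤ (Sp F (h :: hs) (B ∪ univ.image C)).comap
      (LinearMap.mulLeft F (minor C)) := by
    refine Submodule.span_le.mpr fun p hp => ?_
    exact Submodule.subset_span (Gen.cons C hC hd rfl hp)
  exact this hv

lemma exists_perm {h : ℕ} {B : Finset A} {C C' : Fin h → A} (hC : Function.Injective C)
    (hC' : Function.Injective C') (hCB : ∀ i, C i ∈ B) (hCB' : ∀ i, C' i ∈ B) :
    ∃ π : Equiv.Perm A, Fix π B ∧ ∀ i, π (C i) = C' i := by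
  have := Equiv.Perm.isMultiplyPretransitive (↥B) h
  let x : Fin h ↪ ↥B := ⟨fun i => ⟨C i, hCB i⟩, fun i j hij => hC (congrArg Subtype.val hij)⟩
  let y : Fin h ↪ ↥B := ⟨fun i => ⟨C' i, hCB' i⟩, fun i j hij => hC' (congrArg Subtype.val hij)⟩
  obtain ⟨g, hg⟩ := MulAction.exists_smul_eq (Equiv.Perm ↥B) x y
  refine ⟨Equiv.Perm.ofSubtype g, fun a ha => Equiv.Perm.ofSubtype_apply_of_not_mem g ha,
    fun i => ?_⟩
  rw [Equiv.Perm.ofSubtype_apply_of_mem g (hCB i)]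
  have := congrArg Subtype.val (DFunLike.congr_fun hg i)
  exact this

lemma minor_dep {h : ℕ} (C : Fin h → A) {g g' : A → ℕ} (hg : ∀ i, g (C i) = g' (C i)) :
    (minor C : Wd F A) g = minor C g' := by
  simp only [minor, hg]

lemma AS_minor_mul {h : ℕ} {B : Finset A} {v : Wd F A} {C : Fin h → A}
    (hC : Function.Injective C) (hd : ∀ i, C i ∉ B)
    (hv : ∀ g g' : A → ℕ, (∀ a ∈ B, g a = g' a) → v g = v g') : AS C (minor C * v) := by
  intro i j hij
  rw [act_prod, act_minor]
  have h1 : ⇑(Equiv.swap (C i) (C j)) ∘ C = C ∘ Equiv.swap i j := by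
    funext k
    simp [hC.swap_apply]
  have h2 : act (Equiv.swap (C i) (C j)) v = v := by
    funext g
    apply hv
    intro a ha
    rw [Function.comp_apply, Equiv.swap_apply_of_ne_of_ne]
    · rintro rfl; exact hd i ha
    · rintro rfl; exact hd j ha
  rw [h1, h2, minor_comp_perm, Equiv.Perm.sign_swap hij]
  simp

lemma rho_minor_mul {h : ℕ} {B : Finset A} {v : Wd F A} {C : Fin h → A}
    (hC : Function.Injective C) (hd : ∀ i, C i ∉ B)
    (hv : ∀ g g' : A → ℕ, (∀ a ∈ B, g a = g' a) → v g = v g') : rho C (minor C * v) = v := by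
  funext g
  rw [rho_apply, Pi.mul_apply, minor_std C (ov_mem hC g), one_mul]
  apply hv
  intro a ha
  rw [ov_not]
  rintro i rfl
  exact hd i ha

lemma raise_minor {h : ℕ} {C : Fin h → A} (hC : Function.Injective C) {q : ℕ} (hq : 1 ≤ q)
    (g : A → ℕ) : raise (univ.image C) q (minor C : Wd F A) g = 0 := by
  rw [raise_apply, Finset.filter_image, Finset.sum_image (fun i _ j _ hij => hC hij)]
  by_cases hqh : q < h
  · let M : Matrix (Fin h) (Fin h) F :=
      Matrix.of fun i j : Fin h => if g (C i) = (j : ℕ) + 1 then (1 : F) else 0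
    let q0 : Fin h := ⟨q - 1, by omega⟩
    let q1 : Fin h := ⟨q, hqh⟩
    have h1 : ∀ i, (minor C : Wd F A) (Function.update g (C i) (q + 1)) = M.adjugate q1 i := by
      intro i
      rw [Matrix.adjugate_apply]
      unfold minor
      congr 1
      ext k j
      by_cases hk : k = i
      · subst hk
        simp [Pi.single_apply, q1, Fin.ext_iff, eq_comm]
      · rw [Matrix.updateRow_ne hk]
        have : C k ≠ C i := fun h => hk (hC h)
        simp [M, Function.update_of_ne this]
    have h2 : (M.adjugate * M) q1 q0 = 0 := by
      rw [Matrix.adjugate_mul]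
      have : q1 ≠ q0 := by
        simp only [q1, q0, ne_eq, Fin.mk.injEq]
        omega
      simp [this]
    rw [Matrix.mul_apply] at h2
    rw [← h2, Finset.sum_filter]
    apply Finset.sum_congr rfl
    intro i _
    rw [h1]
    have : g (C i) = q - 1 + 1 ↔ g (C i) = q := by omega
    simp [M, q0, this]
  · apply Finset.sum_eq_zero
    intro i _
    apply minor_eq_zero_of_range C (i := i)
    simp
    omega

lemma card_filter_union {h : ℕ} {C : Fin h → A} (hC : Function.Injective C) {B : Finset A}
    (hd : ∀ i, C i ∉ B) (g : A → ℕ) (i : ℕ) :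
    ((B ∪ univ.image C).filter (fun a => g a = i)).card
      = (B.filter (fun a => g a = i)).card + (univ.filter (fun k => g (C k) = i)).card := by
  have hdisj : Disjoint B (univ.image C) := by
    rw [Finset.disjoint_right]
    intro a ha
    obtain ⟨i, _, rfl⟩ := Finset.mem_image.mp ha
    exact hd i
  rw [Finset.filter_union, Finset.card_union_of_disjoint
    (Finset.disjoint_filter_filter hdisj), Finset.filter_image,
    Finset.card_image_of_injective _ hC]

lemma minor_mul_mem_Ker {h : ℕ} {hs : List ℕ} {B : Finset A} {v : Wd F A} {C : Fin h → A}
    (hC : Function.Injective C) (hd : ∀ i, C i ∉ B) (hv : v ∈ Ker F hs B) :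
    minor C * v ∈ Ker F (h :: hs) (B ∪ univ.image C) := by
  rw [mem_Ker] at hv ⊢
  refine ⟨⟨fun g g' hgg => ?_, fun g hg i => ?_⟩, fun q hq g => ?_⟩
  · rw [Pi.mul_apply, Pi.mul_apply]
    congr 1
    · exact minor_dep C fun i => hgg _ (by simp)
    · exact hv.1.1 g g' fun a ha => hgg a (by simp [ha])
  · rw [Pi.mul_apply] at hg
    have h1 := left_ne_zero_of_mul hg
    have h2 := right_ne_zero_of_mul hg
    rw [card_filter_union hC hd, hv.1.2 g h2, wt_cons]
    congr 1
    have hinj : ∀ i j, i ≠ j → g (C i) ≠ g (C j) := fun i j hij hg =>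
      h1 (minor_eq_zero_of_eq C hij hg)
    have hr : ∀ i, 1 ≤ g (C i) ∧ g (C i) ≤ h := by
      intro i
      by_contra hi
      exact h1 (minor_eq_zero_of_range C hi)
    obtain ⟨τ, hτ⟩ := exists_perm_of_inj hinj hr
    split_ifs with hi
    · rw [Finset.card_eq_one]
      refine ⟨τ⁻¹ ⟨i - 1, by omega⟩, ?_⟩
      ext k
      simp only [Finset.mem_filter, Finset.mem_univ, true_and, Finset.mem_singleton, hτ]
      rw [Equiv.Perm.eq_inv_iff_eq, Fin.ext_iff]
      simp only
      omega
    · rw [Finset.card_eq_zero, Finset.filter_eq_empty_iff]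
      intro k _ hk
      exact hi (hk ▸ hr k)
  · have hdisj : Disjoint B (univ.image C) := by
      rw [Finset.disjoint_right]
      intro a ha
      obtain ⟨i, _, rfl⟩ := Finset.mem_image.mp ha
      exact hd i
    rw [raise_apply, Finset.filter_union,
      Finset.sum_union (Finset.disjoint_filter_filter hdisj)]
    have e1 : ∑ a ∈ B.filter (fun a => g a = q),
        (minor C * v : Wd F A) (Function.update g a (q + 1)) = minor C g * raise B q v g := by
      rw [raise_apply, Finset.mul_sum]
      apply Finset.sum_congr rfl
      intro a ha
      rw [Pi.mul_apply]
      congr 1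
      apply minor_dep
      intro i
      rw [Function.update_of_ne]
      rintro rfl
      exact hd i (Finset.mem_filter.mp ha).1
    have e2 : ∑ a ∈ (univ.image C).filter (fun a => g a = q),
        (minor C * v : Wd F A) (Function.update g a (q + 1))
        = raise (univ.image C) q (minor C) g * v g := by
      rw [raise_apply, Finset.sum_mul]
      apply Finset.sum_congr rfl
      intro a ha
      rw [Pi.mul_apply]
      congr 1
      apply hv.1.1
      intro b hb
      rw [Function.update_of_ne]
      rintro rfl
      exact Finset.disjoint_left.mp hdisj hb (Finset.mem_filter.mp ha).1
    rw [e1, e2, hv.2 q hq, raise_minor hC hq]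
    simp

lemma Gen.mem_Ker {hs : List ℕ} {B : Finset A} {p : Wd F A} (hp : Gen F hs B p) :
    p ∈ Ker F hs B := by
  induction hp with
  | nil =>
    rw [CarterPayne.mem_Ker]
    refine ⟨⟨fun g g' _ => rfl, fun g _ i => by simp [wt]⟩, fun q _ g => by simp [raise_apply]⟩
  | cons C hC hd hB hp ih =>
    subst hB
    exact minor_mul_mem_Ker hC hd ih

lemma Sp_le_Ker (hs : List ℕ) (B : Finset A) : Sp F hs B ≤ Ker F hs B :=
  Submodule.span_le.mpr fun _ hp => hp.mem_Ker

lemma Ker_le_Wt (hs : List ℕ) (B : Finset A) : Ker F hs B ≤ Wt F hs B := inf_le_left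

lemma Sp_le_Wt (hs : List ℕ) (B : Finset A) : Sp F hs B ≤ Wt F hs B :=
  (Sp_le_Ker hs B).trans (Ker_le_Wt hs B)

lemma Wt_act {hs : List ℕ} {B : Finset A} {v : Wd F A} (hv : v ∈ Wt F hs B)
    {π : Equiv.Perm A} (hπ : Fix π B) : act π v ∈ Wt F hs B := by
  refine ⟨fun g g' hgg => hv.1 _ _ fun a ha => hgg _ (hπ.mem.mpr ha), fun g hg i => ?_⟩
  rw [← hv.2 _ hg i]
  symm
  apply Finset.card_equiv π
  intro a
  simp [hπ.mem]

lemma Ker_act {hs : List ℕ} {B : Finset A} {v : Wd F A} (hv : v ∈ Ker F hs B)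
    {π : Equiv.Perm A} (hπ : Fix π B) : act π v ∈ Ker F hs B := by
  rw [mem_Ker] at hv ⊢
  refine ⟨Wt_act hv.1 hπ, fun q hq g => ?_⟩
  rw [← hv.2 q hq (g ∘ π), raise_apply, raise_apply]
  symm
  apply Finset.sum_equiv π
  · intro a
    simp [hπ.mem]
  · intro a _
    rw [act_apply]
    congr 1
    funext b
    by_cases hb : b = a
    · subst hb; simp
    · rw [Function.update_of_ne hb, Function.comp_apply, Function.comp_apply,
        Function.update_of_ne (fun h => hb (π.injective h))]

/-- The Jucys-Murphy element of `n` in `B`. -/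
def L (F : Type*) [Field F] (B : Finset A) (n : A) : Module.End F (Wd F A) :=
  ∑ k ∈ B.erase n, act (Equiv.swap k n)

lemma L_apply (B : Finset A) (n : A) (v : Wd F A) :
    L F B n v = ∑ k ∈ B.erase n, act (Equiv.swap k n) v := by
  simp [L]

lemma L_mem_Sp {hs : List ℕ} {B : Finset A} {n : A} (hn : n ∈ B) {v : Wd F A}
    (hv : v ∈ Sp F hs B) : L F B n v ∈ Sp F hs B := by
  rw [L_apply]
  exact Submodule.sum_mem _ fun k hk => Sp_act hv (Fix.swap (Finset.mem_of_mem_erase hk) hn)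

lemma aeval_mem {V : Type*} [AddCommGroup V] [Module F V] {S : Submodule F V}
    {T : Module.End F V} (hT : ∀ v ∈ S, T v ∈ S) (p : Polynomial F) {v : V} (hv : v ∈ S) :
    Polynomial.aeval T p v ∈ S := by
  induction p using Polynomial.induction_on' generalizing v with
  | add p q hp hq =>
    rw [map_add, LinearMap.add_apply]
    exact S.add_mem (hp hv) (hq hv)
  | monomial k a =>
    rw [Polynomial.aeval_monomial, Module.End.mul_apply, Module.algebraMap_end_apply]
    apply S.smul_mem
    induction k generalizing v with
    | zero => simpa
    | succ k ih =>
      rw [pow_succ, Module.End.mul_apply]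
      exact ih (hT v hv)

lemma aeval_comm {V : Type*} [AddCommGroup V] [Module F V] {S : Submodule F V}
    {T : Module.End F V} (hT : ∀ v ∈ S, T v ∈ S) {W : Type*} [AddCommGroup W] [Module F W]
    {T' : Module.End F W} {f : V →ₗ[F] W}
    (hf : ∀ v ∈ S, f (T v) = T' (f v)) (p : Polynomial F) {v : V} (hv : v ∈ S) :
    f (Polynomial.aeval T p v) = Polynomial.aeval T' p (f v) := by
  induction p using Polynomial.induction_on' generalizing v with
  | add p q hp hq => simp [hp hv, hq hv]
  | monomial k a =>
    simp only [Polynomial.aeval_monomial, Module.End.mul_apply, Module.algebraMap_end_apply,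
      map_smul]
    congr 1
    induction k generalizing v with
    | zero => simp
    | succ k ih =>
      rw [pow_succ, pow_succ, Module.End.mul_apply, Module.End.mul_apply, ih (hT v hv), hf v hv]

lemma act_conj (π : Equiv.Perm A) (a b : A) (v : Wd F A) :
    act π (act (Equiv.swap a b) v) = act (Equiv.swap (π a) (π b)) (act π v) := by
  rw [← act_mul, ← act_mul]
  congr 1
  rw [Equiv.swap_apply_apply, inv_mul_cancel_right]

/-- Conjugation of Jucys-Murphy elements. -/
lemma act_L {B B' : Finset A} {n : A} {π : Equiv.Perm A} (hB : ∀ a, π a ∈ B' ↔ a ∈ B)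
    (v : Wd F A) : act π (L F B n v) = L F B' (π n) (act π v) := by
  rw [L_apply, L_apply, map_sum]
  apply Finset.sum_equiv π
  · intro a
    simp [hB]
  · intro a _
    rw [act_conj]

end Core

open Finset
set_option linter.unusedSectionVars false

section Core

variable {F : Type*} [Field F] {A : Type*} [Fintype A] [DecidableEq A]

lemma swap_mul_swap_left {a b c : A} (hac : a ≠ c) (hab : a ≠ b) :
    Equiv.swap a c * Equiv.swap b c = Equiv.swap b c * Equiv.swap a b := by
  have := Equiv.swap_apply_apply (Equiv.swap b c) a b
  rw [Equiv.swap_apply_of_ne_of_ne hab hac, Equiv.swap_apply_left] at this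
  rw [this]
  simp

lemma P_AS {m : ℕ} {C : Fin (m + 1) → A} (hC : Function.Injective C) {u : Wd F A}
    (hu : AS (C ∘ Fin.castSucc) u) :
    AS C (u - ∑ i : Fin m, act (Equiv.swap (C i.castSucc) (C (Fin.last m))) u) := by
  have hne : ∀ i : Fin m, C i.castSucc ≠ C (Fin.last m) := fun i h =>
    (Fin.castSucc_lt_last i).ne (hC h)
  have key : ∀ x : Fin m, act (Equiv.swap (C x.castSucc) (C (Fin.last m)))
      (u - ∑ i : Fin m, act (Equiv.swap (C i.castSucc) (C (Fin.last m))) u)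
      = -(u - ∑ i : Fin m, act (Equiv.swap (C i.castSucc) (C (Fin.last m))) u) := by
    intro x
    rw [map_sub, map_sum, ← Finset.add_sum_erase _ _ (Finset.mem_univ x),
      ← Finset.add_sum_erase univ (fun i : Fin m =>
        act (Equiv.swap (C i.castSucc) (C (Fin.last m))) u) (Finset.mem_univ x)]
    have h1 : ∀ i ∈ univ.erase x, act (Equiv.swap (C x.castSucc) (C (Fin.last m)))
        (act (Equiv.swap (C i.castSucc) (C (Fin.last m))) u)
        = - act (Equiv.swap (C i.castSucc) (C (Fin.last m))) u := by
      intro i hi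
      rw [← act_mul, swap_mul_swap_left (hne x) (fun h => (Finset.ne_of_mem_erase hi).symm
        (Fin.castSucc_injective m (hC h))), act_mul]
      have := hu x i (Finset.ne_of_mem_erase hi).symm
      rw [Function.comp_apply, Function.comp_apply] at this
      rw [this, map_neg]
    rw [Finset.sum_congr rfl h1, ← act_mul, Equiv.swap_mul_self, act_one,
      Finset.sum_neg_distrib]
    abel
  intro x y hxy
  induction x using Fin.lastCases with
  | last =>
    induction y using Fin.lastCases with
    | last => exact absurd rfl hxy
    | cast y => rw [Equiv.swap_comm]; exact key y
  | cast x =>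
    induction y using Fin.lastCases with
    | last => exact key x
    | cast y =>
      have hxy' : x ≠ y := fun h => hxy (by rw [h])
      have h0 := hu x y hxy'
      rw [Function.comp_apply, Function.comp_apply] at h0
      rw [map_sub, map_sum, h0]
      have h1 : ∀ i, act (Equiv.swap (C x.castSucc) (C y.castSucc))
          (act (Equiv.swap (C i.castSucc) (C (Fin.last m))) u)
          = - act (Equiv.swap (C (Equiv.swap x y i).castSucc) (C (Fin.last m))) u := by
        intro i
        rw [act_conj, h0, map_neg, Equiv.swap_apply_of_ne_of_ne (hne x).symm (hne y).symm]
        have : Equiv.swap (C x.castSucc) (C y.castSucc) (C i.castSucc)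
            = C (Equiv.swap x y i).castSucc :=
          (hC.comp (Fin.castSucc_injective m)).swap_apply x y i
        rw [this]
      rw [Finset.sum_congr rfl (fun i _ => h1 i), Finset.sum_neg_distrib,
        Equiv.sum_comp (Equiv.swap x y)
          (fun i => act (Equiv.swap (C i.castSucc) (C (Fin.last m))) u)]
      abel

/-- Garnir-type relation. -/
lemma garnir (h2 : (2 : F) ≠ 0) {l : ℕ} {hs : List ℕ} (hl : ∀ h ∈ hs, h ≤ l) {B : Finset A}
    {v : Wd F A} (hv : v ∈ Wt F hs B) {C : Fin l → A} (hC : Function.Injective C)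
    (hCB : ∀ i, C i ∈ B) (has : AS C v) {n : A} (hn : n ∈ B) (hnC : ∀ i, C i ≠ n) :
    v = ∑ i, act (Equiv.swap (C i) n) v := by
  have hD : Function.Injective (Fin.snoc C n : Fin (l + 1) → A) := by
    rw [Fin.snoc_injective_iff]
    refine ⟨hC, ?_⟩
    rintro ⟨i, hi⟩
    exact hnC i hi
  have hDB : ∀ i, (Fin.snoc C n : Fin (l + 1) → A) i ∈ B := by
    intro i
    induction i using Fin.lastCases with
    | last => simpa
    | cast i => simpa using hCB i
  have h1 := P_AS (u := v) hD (by
    intro i j hij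
    simpa using has i j hij)
  simp only [Fin.snoc_castSucc, Fin.snoc_last] at h1
  set w := v - ∑ i, act (Equiv.swap (C i) n) v with hw
  have hwW : w ∈ Wt F hs B :=
    Submodule.sub_mem _ hv (Submodule.sum_mem _ fun i _ => Wt_act hv (Fix.swap (hCB i) hn))
  have : w = 0 := by
    funext g
    by_cases hr : ∀ i, 1 ≤ g ((Fin.snoc C n : Fin (l + 1) → A) i) ∧
        g ((Fin.snoc C n : Fin (l + 1) → A) i) ≤ l
    · have : ∃ x ∈ (univ : Finset (Fin (l + 1))), ∃ y ∈ (univ : Finset (Fin (l + 1))), x ≠ y ∧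
          g ((Fin.snoc C n : Fin (l + 1) → A) x) = g ((Fin.snoc C n : Fin (l + 1) → A) y) := by
        apply Finset.exists_ne_map_eq_of_card_lt_of_maps_to (t := Finset.Icc 1 l)
        · simp
        · intro i _
          simpa using hr i
      obtain ⟨x, _, y, _, hxy, hg⟩ := this
      exact h1.zero h2 hxy hg
    · rw [not_forall] at hr
      obtain ⟨i, hi⟩ := hr
      exact Wt.zero_of_range hwW hl (hDB i) hi
  rw [hw, sub_eq_zero] at this
  exact this

lemma Sp_cons_ext {h : ℕ} {hs : List ℕ} {B : Finset A} {f g : Wd F A →ₗ[F] Wd F A}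
    (H : ∀ (C : Fin h → A) (B' : Finset A), Function.Injective C → (∀ i, C i ∉ B') →
      B = B' ∪ univ.image C → ∀ v ∈ Sp F hs B', f (minor C * v) = g (minor C * v)) :
    ∀ v ∈ Sp F (h :: hs) B, f v = g v := by
  have : Sp F (h :: hs) B ≤ LinearMap.eqLocus f g := by
    refine Submodule.span_le.mpr fun p hp => ?_
    cases hp with
    | cons C hC hd hB hp => exact H C _ hC hd hB _ (Submodule.subset_span hp)
  exact fun v hv => this hv

lemma Sp_cons_cases {h : ℕ} (hs : List ℕ) (B : Finset A) :
    Sp F (h :: hs) B = ⊥ ∨ ∃ (C : Fin h → A) (B' : Finset A), Function.Injective C ∧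
      (∀ i, C i ∉ B') ∧ B = B' ∪ univ.image C := by
  by_cases hE : ∃ p, Gen F (h :: hs) B p
  · obtain ⟨p, hp⟩ := hE
    cases hp with
    | cons C hC hd hB hp => exact Or.inr ⟨C, _, hC, hd, hB⟩
  · left
    rw [Sp, Submodule.span_eq_bot]
    intro p hp
    exact absurd ⟨p, hp⟩ hE

lemma transfer {h : ℕ} {hs : List ℕ} {B0 B1 : Finset A} {C0 C1 : Fin h → A}
    (hd0 : ∀ i, C0 i ∉ B0) (hd1 : ∀ i, C1 i ∉ B1)
    (hB : B0 ∪ univ.image C0 = B1 ∪ univ.image C1) {π : Equiv.Perm A}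
    (hπ : Fix π (B0 ∪ univ.image C0)) (hπC : ∀ i, π (C0 i) = C1 i) {v : Wd F A}
    (hv : v ∈ Sp F hs B1) :
    ∃ v' ∈ Sp F hs B0, minor C1 * v = act π (minor C0 * v') := by
  have himg : B1.image ⇑(π⁻¹) = B0 := by
    ext a
    rw [Finset.mem_image]
    constructor
    · rintro ⟨b, hb, rfl⟩
      have h1 : π⁻¹ b ∈ B0 ∪ univ.image C0 := by
        rw [hπ.inv.mem, hB]
        exact Finset.mem_union_left _ hb
      rcases Finset.mem_union.mp h1 with h1 | h1
      · exact h1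
      · exfalso
        obtain ⟨i, _, hi⟩ := Finset.mem_image.mp h1
        apply hd1 i
        rw [← hπC, hi]
        simpa using hb
    · intro ha
      refine ⟨π a, ?_, by simp⟩
      have h1 : π a ∈ B1 ∪ univ.image C1 := by
        rw [← hB, hπ.mem]
        exact Finset.mem_union_left _ ha
      rcases Finset.mem_union.mp h1 with h1 | h1
      · exact h1
      · exfalso
        obtain ⟨i, _, hi⟩ := Finset.mem_image.mp h1
        rw [← hπC] at hi
        rw [← π.injective hi] at ha
        exact hd0 i ha
  refine ⟨act π⁻¹ v, ?_, ?_⟩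
  · have : Sp F hs B1 ≤ (Sp F hs B0).comap (act π⁻¹) := by
      refine Submodule.span_le.mpr fun p hp => ?_
      have := hp.act π⁻¹
      rw [himg] at this
      exact Submodule.subset_span this
    exact this hv
  · rw [act_prod, act_minor, ← act_mul, mul_inv_cancel, act_one]
    congr 2
    funext i
    exact (hπC i).symm

lemma act_minor_fix {h : ℕ} {C : Fin h → A} {π : Equiv.Perm A} (hπ : ∀ i, π (C i) = C i)
    (v : Wd F A) : act π (minor C * v) = minor C * act π v := by
  rw [act_prod, act_minor]
  congr 2
  funext i
  exact hπ i

lemma schur (h2 : (2 : F) ≠ 0) : ∀ (hs : List ℕ), hs.Pairwise (fun a b => b ≤ a) →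
    ∀ (B : Finset A) (ψ : Wd F A →ₗ[F] Wd F A), (∀ v ∈ Sp F hs B, ψ v ∈ Wt F hs B) →
    (∀ π, Fix π B → ∀ v ∈ Sp F hs B, ψ (act π v) = act π (ψ v)) →
    ∃ a : F, ∀ v ∈ Sp F hs B, ψ v = a • v := by
  intro hs
  induction hs with
  | nil =>
    intro _ B ψ hψ _
    by_cases hE : (1 : Wd F A) ∈ Sp F [] B
    · have hW := hψ 1 hE
      have hB : Gen F [] B (1 : Wd F A) → B = ∅ := fun hp => by cases hp; rfl
      refine ⟨ψ 1 0, ?_⟩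
      have : Sp F [] B ≤ LinearMap.eqLocus ψ ((ψ 1 0) • LinearMap.id) := by
        refine Submodule.span_le.mpr fun p hp => ?_
        cases hp with
        | nil =>
          change ψ 1 = ψ 1 0 • (1 : Wd F A)
          funext g
          rw [hW.1 g 0 (by simp)]
          simp
      exact fun v hv => this hv
    · refine ⟨0, fun v hv => ?_⟩
      have : Sp F [] B ≤ (⊥ : Submodule F (Wd F A)) := by
        refine Submodule.span_le.mpr fun p hp => ?_
        have hp' := hp
        cases hp with
        | nil => exact absurd (Submodule.subset_span hp') hE
      rw [(Submodule.mem_bot F).mp (this hv)]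
      simp
  | cons h hs ih =>
    intro hsort B ψ hψ heq
    rw [List.pairwise_cons] at hsort
    rcases Sp_cons_cases (F := F) (h := h) hs B with hbot | ⟨C, B', hC, hd, rfl⟩
    · refine ⟨0, fun v hv => ?_⟩
      rw [hbot] at hv
      rw [(Submodule.mem_bot F).mp hv]
      simp
    have hfixC : ∀ π, Fix π B' → ∀ i, π (C i) = C i := fun π hπ i => hπ _ (hd i)
    obtain ⟨a, ha⟩ := ih hsort.2 B' ((rho C) ∘ₗ ψ ∘ₗ LinearMap.mulLeft F (minor C))
      (by
        intro v hv
        exact rho_mem_Wt hC hd (hψ _ (minor_mul_mem hC hd hv)))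
      (by
        intro π hπ v hv
        simp only [LinearMap.comp_apply, LinearMap.mulLeft_apply]
        rw [← act_minor_fix (hfixC π hπ), heq π (hπ.mono Finset.subset_union_left) _
          (minor_mul_mem hC hd hv), rho_act hC _ _ (hfixC π hπ)])
    simp only [LinearMap.comp_apply, LinearMap.mulLeft_apply] at ha
    have hkey : ∀ v ∈ Sp F hs B', ψ (minor C * v) = a • (minor C * v) := by
      intro v hv
      have hmem := minor_mul_mem hC hd hv
      have has : AS C (ψ (minor C * v)) := by
        intro i j hij
        rw [← heq _ (Fix.swap (by simp) (by simp)) _ hmem,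
          AS_minor_mul hC hd (Sp_le_Wt _ _ hv).1 i j hij, map_neg]
      rw [div_minor h2 (hψ _ hmem) hsort.1 hC (by simp) has, ha v hv]
      simp
    have hfin : ∀ v ∈ Sp F (h :: hs) (B' ∪ univ.image C),
        ψ v = (a • (LinearMap.id : Wd F A →ₗ[F] Wd F A)) v := ?_
    · exact ⟨a, hfin⟩
    refine Sp_cons_ext ?_
    intro C1 B1 hC1 hd1 hB1 v hv
    obtain ⟨π, hπ, hπC⟩ := exists_perm (B := B' ∪ univ.image C) hC hC1 (by simp)
      (by rw [hB1]; simp)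
    obtain ⟨v', hv', hvv⟩ := transfer hd hd1 hB1 hπ hπC hv
    rw [hvv, heq π hπ _ (minor_mul_mem hC hd hv'), hkey v' hv', map_smul]
    rfl

end Core

open Finset
set_option linter.unusedSectionVars false

section Core

variable {F : Type*} [Field F] {A : Type*} [Fintype A] [DecidableEq A]

/-- The restriction statement for a list of column heights. -/
def ResP (F : Type*) [Field F] (A : Type*) [Fintype A] [DecidableEq A] (hs : List ℕ) : Prop :=
  ∀ (B : Finset A) (n : A), n ∈ B → ∀ ψ : Wd F A →ₗ[F] Wd F A,
    (∀ v ∈ Sp F hs B, ψ v ∈ Ker F hs B) →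
    (∀ π, Fix π (B.erase n) → ∀ v ∈ Sp F hs B, ψ (act π v) = act π (ψ v)) →
    ∃ p : Polynomial F, ∀ v ∈ Sp F hs B, ψ v = Polynomial.aeval (L F B n) p v

lemma act_aeval_L {B : Finset A} {n : A} {π : Equiv.Perm A} (hπ : Fix π (B.erase n))
    (p : Polynomial F) (v : Wd F A) :
    act π (Polynomial.aeval (L F B n) p v) = Polynomial.aeval (L F B n) p (act π v) := by
  refine aeval_comm (S := ⊤) (fun _ _ => Submodule.mem_top) (fun v _ => ?_) p Submodule.mem_top
  rw [act_L (B' := B) (fun a => (hπ.mono (Finset.erase_subset _ _)).mem), hπ n (by simp)]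

lemma AS.hz (h2 : (2 : F) ≠ 0) {h : ℕ} {C : Fin h → A} (hC : Function.Injective C) {u : Wd F A}
    (hu : AS C u) (i : Fin h) (hi : (i : ℕ) + 1 < h) (g : A → ℕ) :
    u (Function.update (ov C g) (C i) ((i : ℕ) + 2)) = 0 := by
  have hne : i ≠ ⟨i + 1, hi⟩ := by
    intro h
    have := congrArg Fin.val h
    simp at this
  apply hu.zero h2 hne
  have : C ⟨i + 1, hi⟩ ≠ C i := fun h => hne (hC h).symm
  rw [Function.update_self, Function.update_of_ne this, ov_mem hC]

lemma Gen_swap {l : ℕ} {hs : List ℕ} {B : Finset A} {p : Wd F A} (hp : Gen F (l :: l :: hs) B p)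
    (n : A) : ∃ (C : Fin l → A) (B' : Finset A) (p' : Wd F A), Function.Injective C ∧
      (∀ i, C i ∉ B') ∧ B = B' ∪ univ.image C ∧ (∀ i, C i ≠ n) ∧ p = minor C * p' ∧
      Gen F (l :: hs) B' p' := by
  cases hp with
  | @cons _ _ B1 _ p1 C1 hC1 hd1 hB1 hp1 =>
    by_cases hn : ∀ i, C1 i ≠ n
    · exact ⟨C1, B1, p1, hC1, hd1, hB1, hn, rfl, hp1⟩
    · push Not at hn
      obtain ⟨i, hi⟩ := hn
      cases hp1 with
      | @cons _ _ B2 _ p2 C2 hC2 hd2 hB2 hp2 =>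
        subst hB2 hB1
        simp only [Finset.mem_union, Finset.mem_image, Finset.mem_univ, true_and, not_or,
          not_exists] at hd1
        refine ⟨C2, B2 ∪ univ.image C1, minor C1 * p2, hC2, ?_, ?_, ?_, ?_, ?_⟩
        · intro j hj
          simp only [Finset.mem_union, Finset.mem_image, Finset.mem_univ, true_and] at hj
          rcases hj with hj | ⟨k, hk⟩
          · exact hd2 j hj
          · exact (hd1 k).2 j hk.symm
        · rw [Finset.union_right_comm]
        · intro j hj
          exact (hd1 i).2 j (hj.trans hi.symm)
        · ring
        · exact Gen.cons C1 hC1 (fun j => (hd1 j).1) rfl hp2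

lemma L_minor_mul (h2 : (2 : F) ≠ 0) {l : ℕ} {hs : List ℕ} (hl : ∀ h ∈ hs, h ≤ l)
    {B : Finset A} {n : A} (hn : n ∈ B) {C : Fin l → A} (hC : Function.Injective C)
    (hd : ∀ i, C i ∉ B) {v : Wd F A} (hv : v ∈ Sp F hs B) :
    L F (B ∪ univ.image C) n (minor C * v) = minor C * (L F B n v + v) := by
  have hnC : ∀ i, C i ≠ n := by
    rintro i rfl
    exact hd i hn
  have hdisj : Disjoint (B.erase n) (univ.image C) := by
    rw [Finset.disjoint_right]
    intro a ha
    obtain ⟨i, _, rfl⟩ := Finset.mem_image.mp ha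
    exact fun h => hd i (Finset.mem_of_mem_erase h)
  have he : (B ∪ univ.image C).erase n = B.erase n ∪ univ.image C := by
    rw [Finset.erase_union_distrib]
    congr 1
    apply Finset.erase_eq_of_notMem
    simp [hnC]
  have hg := garnir h2 (l := l) (hs := l :: hs) (by simpa using hl)
    (Sp_le_Wt _ _ (minor_mul_mem hC hd hv)) hC (by simp) (AS_minor_mul hC hd (Sp_le_Wt _ _ hv).1)
    (n := n) (by simp [hn]) hnC
  rw [L_apply, he, Finset.sum_union hdisj, Finset.sum_image (fun i _ j _ hij => hC hij), ← hg,
    mul_add, L_apply, Finset.mul_sum]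
  congr 1
  apply Finset.sum_congr rfl
  intro k hk
  apply act_minor_fix
  intro i
  apply Equiv.swap_apply_of_ne_of_ne
  · rintro rfl; exact hd i (Finset.mem_of_mem_erase hk)
  · exact hnC i

lemma res_caseI (h2 : (2 : F) ≠ 0) {l : ℕ} {hs : List ℕ} (hl : ∀ h ∈ hs, h ≤ l)
    (ih : ResP F A (l :: hs)) : ResP F A (l :: l :: hs) := by
  intro B n hn ψ hψ heq
  by_cases hE : ∃ p, Gen F (l :: l :: hs) B p
  swap
  · refine ⟨0, fun v hv => ?_⟩
    have hbot : Sp F (l :: l :: hs) B = ⊥ := by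
      rw [Sp, Submodule.span_eq_bot]
      intro p hp
      exact absurd ⟨p, hp⟩ hE
    rw [hbot] at hv
    rw [(Submodule.mem_bot F).mp hv]
    simp
  obtain ⟨p0, hp0⟩ := hE
  obtain ⟨C, B', _, hC, hd, hB, hnC, _, _⟩ := Gen_swap hp0 n
  subst hB
  have hl' : ∀ h ∈ l :: hs, h ≤ l := by simpa using hl
  have hnB : n ∈ B' := by
    simpa [hnC] using hn
  have hCe : ∀ i, C i ∈ (B' ∪ univ.image C).erase n := fun i => by simp [hnC]
  have has : ∀ v ∈ Sp F (l :: hs) B', AS C (ψ (minor C * v)) := by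
    intro v hv i j hij
    rw [← heq _ (Fix.swap (hCe i) (hCe j)) _ (minor_mul_mem hC hd hv),
      AS_minor_mul hC hd (Sp_le_Wt _ _ hv).1 i j hij, map_neg]
  have hfixC : ∀ π, Fix π (B'.erase n) → ∀ i, π (C i) = C i :=
    fun π hπ i => hπ _ (fun h => hd i (Finset.mem_of_mem_erase h))
  obtain ⟨p, hp⟩ := ih B' n hnB ((rho C) ∘ₗ ψ ∘ₗ LinearMap.mulLeft F (minor C))
    (by
      intro v hv
      exact rho_mem_Ker hC hd (hψ _ (minor_mul_mem hC hd hv)) hl'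
        (fun i hi g => (has v hv).hz h2 hC i hi g))
    (by
      intro π hπ v hv
      simp only [LinearMap.comp_apply, LinearMap.mulLeft_apply]
      rw [← act_minor_fix (hfixC π hπ), heq π (hπ.mono
        (Finset.erase_subset_erase _ Finset.subset_union_left)) _
        (minor_mul_mem hC hd hv), rho_act hC _ _ (hfixC π hπ)])
  simp only [LinearMap.comp_apply, LinearMap.mulLeft_apply] at hp
  have hcomm : ∀ q : Polynomial F, ∀ v ∈ Sp F (l :: hs) B',
      minor C * Polynomial.aeval (L F B' n + 1) q v
        = Polynomial.aeval (L F (B' ∪ univ.image C) n) q (minor C * v) := by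
    intro q v hv
    have := aeval_comm (S := Sp F (l :: hs) B') (T := L F B' n + 1)
      (T' := L F (B' ∪ univ.image C) n) (f := LinearMap.mulLeft F (minor C))
      (fun v hv => Submodule.add_mem _ (L_mem_Sp hnB hv) hv)
      (fun v hv => by
        simp only [LinearMap.mulLeft_apply, LinearMap.add_apply, Module.End.one_apply]
        rw [L_minor_mul h2 hl' hnB hC hd hv]) q hv
    exact this
  have hkey : ∀ v ∈ Sp F (l :: hs) B', ψ (minor C * v) =
      Polynomial.aeval (L F (B' ∪ univ.image C) n) (p.comp (Polynomial.X - 1)) (minor C * v) := by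
    intro v hv
    have hmem := minor_mul_mem hC hd hv
    rw [div_minor h2 (Ker_le_Wt _ _ (hψ _ hmem)) hl' hC (by simp) (has v hv), hp v hv,
      ← hcomm _ v hv, Polynomial.aeval_comp]
    simp
  refine ⟨p.comp (Polynomial.X - 1), ?_⟩
  have hle : Sp F (l :: l :: hs) (B' ∪ univ.image C) ≤ LinearMap.eqLocus ψ
      (Polynomial.aeval (L F (B' ∪ univ.image C) n) (p.comp (Polynomial.X - 1))) := by
    refine Submodule.span_le.mpr fun p1 hp1 => ?_
    obtain ⟨C1, B1, p1', hC1, hd1, hB1, hnC1, rfl, hp1'⟩ := Gen_swap hp1 n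
    obtain ⟨π, hπ, hπC⟩ := exists_perm (B := (B' ∪ univ.image C).erase n) hC hC1 hCe
      (by rw [hB1]; simp [hnC1])
    have hπ' := hπ.mono (Finset.erase_subset _ _)
    obtain ⟨v', hv', hvv⟩ := transfer hd hd1 hB1 hπ' hπC (Submodule.subset_span hp1')
    have := heq π hπ _ (minor_mul_mem hC hd hv')
    rw [hkey v' hv', act_aeval_L hπ, ← hvv] at this
    exact this
  exact fun v hv => hle hv

end Core

open Finset
set_option linter.unusedSectionVars false

section Core

variable {F : Type*} [Field F] {A : Type*} [Fintype A] [DecidableEq A]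

lemma wt_top {m : ℕ} {hs : List ℕ} (hl : ∀ h ∈ hs, h ≤ m) : wt ((m + 1) :: hs) (m + 1) = 1 := by
  rw [wt_cons, wt_eq_zero hl (by omega)]
  simp

lemma zero_of_two {m : ℕ} {hs : List ℕ} (hl : ∀ h ∈ hs, h ≤ m) {B : Finset A} {u : Wd F A}
    (hu : u ∈ Wt F ((m + 1) :: hs) B) {a b : A} (hab : a ≠ b) (ha : a ∈ B) (hb : b ∈ B)
    {g : A → ℕ} (hga : g a = m + 1) (hgb : g b = m + 1) : u g = 0 := by
  by_contra hne
  have h1 := hu.2 g hne (m + 1)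
  rw [wt_top hl, Finset.card_eq_one] at h1
  obtain ⟨c, hc⟩ := h1
  have h3 : a ∈ B.filter (fun a => g a = m + 1) := by simp [ha, hga]
  have h4 : b ∈ B.filter (fun a => g a = m + 1) := by simp [hb, hgb]
  rw [hc, Finset.mem_singleton] at h3 h4
  exact hab (h3.trans h4.symm)

lemma rho_mem_Ker2 (h2 : (2 : F) ≠ 0) {m : ℕ} {hs : List ℕ} (hl : ∀ h ∈ hs, h ≤ m)
    {B : Finset A} {u : Wd F A} {C : Fin (m + 1) → A} (hC : Function.Injective C)
    (hd : ∀ i, C i ∉ B) (hu : u ∈ Ker F ((m + 1) :: hs) (B ∪ univ.image C))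
    (has : AS (C ∘ Fin.castSucc) u) : rho C u ∈ Ker F hs B := by
  refine rho_mem_Ker hC hd hu (fun k hk => (hl k hk).trans (Nat.le_succ m)) ?_
  intro i hi g
  by_cases him : (i : ℕ) + 1 < m
  · have hne : (⟨i, by omega⟩ : Fin m) ≠ ⟨i + 1, him⟩ := by
      intro h
      have := congrArg Fin.val h
      simp at this
    apply has.zero h2 hne
    have e1 : (⟨i, by omega⟩ : Fin m).castSucc = i := rfl
    have : C (⟨i + 1, him⟩ : Fin m).castSucc ≠ C i := by
      intro h
      have := congrArg Fin.val (hC h)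
      simp at this
    rw [Function.comp_apply, Function.comp_apply, e1, Function.update_self,
      Function.update_of_ne this, ov_mem hC]
    rfl
  · have hne : C i ≠ C (Fin.last m) := by
      intro h
      have := congrArg Fin.val (hC h)
      simp only [Fin.val_last] at this
      omega
    apply zero_of_two hl (Ker_le_Wt _ _ hu) hne (by simp) (by simp)
    · rw [Function.update_self]
      omega
    · rw [Function.update_of_ne hne.symm, ov_mem hC]
      simp

lemma AS0_act {m : ℕ} {C : Fin (m + 1) → A} (hC : Function.Injective C) {u : Wd F A}
    (hu : AS (C ∘ Fin.castSucc) u) {z : A} (hz : ∀ i, C i ≠ z) :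
    AS (C ∘ Fin.castSucc) (act (Equiv.swap z (C (Fin.last m))) u) := by
  intro i j hij
  have hfix : ∀ i : Fin m, Equiv.swap z (C (Fin.last m)) (C i.castSucc) = C i.castSucc := by
    intro i
    apply Equiv.swap_apply_of_ne_of_ne (hz _)
    exact fun h => (Fin.castSucc_lt_last i).ne (hC h)
  have := act_conj (F := F) (Equiv.swap z (C (Fin.last m))) (C i.castSucc) (C j.castSucc) u
  rw [hfix, hfix] at this
  rw [Function.comp_apply, Function.comp_apply, ← this]
  have h1 := hu i j hij
  rw [Function.comp_apply, Function.comp_apply] at h1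
  rw [h1, map_neg]

lemma kappa_zero (h2 : (2 : F) ≠ 0) {m : ℕ} {hs : List ℕ} (hl : ∀ h ∈ hs, h ≤ m)
    {B : Finset A} {w : Wd F A} {C : Fin (m + 1) → A} (hC : Function.Injective C)
    (hd : ∀ i, C i ∉ B) (hw : w ∈ Wt F ((m + 1) :: hs) (B ∪ univ.image C)) (has : AS C w)
    {z : A} (hz : z ∈ B) : rho C (act (Equiv.swap z (C (Fin.last m))) w) = 0 := by
  have hzC : ∀ i, C i ≠ z := by
    rintro i rfl
    exact hd i hz
  have hl' : ∀ h ∈ (m + 1) :: hs, h ≤ m + 1 := by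
    simpa using fun k hk => (hl k hk).trans (Nat.le_succ m)
  funext g
  rw [rho_apply, act_apply, Pi.zero_apply]
  have e1 : (ov C g ∘ Equiv.swap z (C (Fin.last m))) z = m + 1 := by
    simp [ov_mem hC]
  have e2 : (ov C g ∘ Equiv.swap z (C (Fin.last m))) (C (Fin.last m)) = g z := by
    simp [ov_not g hzC]
  have e3 : ∀ i : Fin m, (ov C g ∘ Equiv.swap z (C (Fin.last m))) (C i.castSucc) = i + 1 := by
    intro i
    rw [Function.comp_apply, Equiv.swap_apply_of_ne_of_ne (hzC _)
      (fun h => (Fin.castSucc_lt_last i).ne (hC h)), ov_mem hC]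
    rfl
  by_cases hr : 1 ≤ g z ∧ g z ≤ m + 1
  · by_cases hm : g z = m + 1
    · exact zero_of_two hl hw (hzC (Fin.last m)).symm (by simp [hz]) (by simp) e1 (e2.trans hm)
    · have hlt : g z - 1 < m := by omega
      apply has.zero h2 (i := (⟨g z - 1, hlt⟩ : Fin m).castSucc) (j := Fin.last m)
      · exact (Fin.castSucc_lt_last _).ne
      · rw [e2, e3]
        simp only
        omega
  · apply Wt.zero_of_range hw hl' (a := C (Fin.last m)) (by simp)
    rwa [e2]

lemma vanish_top {m : ℕ} {hs : List ℕ} (hl : ∀ h ∈ hs, h ≤ m)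
    {B : Finset A} {u : Wd F A} {C : Fin (m + 1) → A} (hC : Function.Injective C)
    (hd : ∀ i, C i ∉ B) (hu : u ∈ Wt F ((m + 1) :: hs) (B ∪ univ.image C))
    (has : AS (C ∘ Fin.castSucc) u) (hrho : rho C u = 0)
    (hkap : ∀ z ∈ B, rho C (act (Equiv.swap z (C (Fin.last m))) u) = 0)
    (g : A → ℕ) (hinj : ∀ i j : Fin m, i ≠ j → g (C i.castSucc) ≠ g (C j.castSucc))
    (hr : ∀ i : Fin m, 1 ≤ g (C i.castSucc) ∧ g (C i.castSucc) ≤ m) : u g = 0 := by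
  have hC0 : Function.Injective (C ∘ Fin.castSucc) := hC.comp (Fin.castSucc_injective m)
  have aux : ∀ (w : Wd F A) (g : A → ℕ), AS (C ∘ Fin.castSucc) w → rho C w = 0 →
      (∀ i j : Fin m, i ≠ j → g (C i.castSucc) ≠ g (C j.castSucc)) →
      (∀ i : Fin m, 1 ≤ g (C i.castSucc) ∧ g (C i.castSucc) ≤ m) →
      g (C (Fin.last m)) = m + 1 → w g = 0 := by
    intro w g hw hrw hinj hr hlast
    obtain ⟨τ, hτ⟩ := exists_perm_of_inj (C := C ∘ Fin.castSucc) (g := g) hinj hr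
    rw [hw.perm hC0 g τ hτ]
    have : ov (C ∘ Fin.castSucc) g = ov C g := by
      funext a
      by_cases ha : ∃ i, C i = a
      · obtain ⟨i, rfl⟩ := ha
        rw [ov_mem hC]
        induction i using Fin.lastCases with
        | last =>
          rw [ov_not, hlast]
          · simp
          · exact fun i h => (Fin.castSucc_lt_last i).ne (hC h)
        | cast i =>
          have := ov_mem hC0 g i
          rw [Function.comp_apply] at this
          rw [this]
          rfl
      · push Not at ha
        rw [ov_not g ha, ov_not]
        exact fun i => ha _
    rw [this]
    have := congrFun hrw g
    rw [rho_apply, Pi.zero_apply] at this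
    rw [this, mul_zero]
  by_contra hne
  have h1 := hu.2 g hne (m + 1)
  rw [wt_top hl, Finset.card_eq_one] at h1
  obtain ⟨z, hz⟩ := h1
  have hz' : z ∈ (B ∪ univ.image C).filter (fun a => g a = m + 1) := by simp [hz]
  rw [Finset.mem_filter] at hz'
  obtain ⟨hzB, hzg⟩ := hz'
  have hnz : ∀ i : Fin m, C i.castSucc ≠ z := by
    rintro i rfl
    have := (hr i).2
    omega
  by_cases hzn : z = C (Fin.last m)
  · subst hzn
    exact hne (aux u g has hrho hinj hr hzg)
  · have hzC : ∀ i, C i ≠ z := by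
      intro i
      induction i using Fin.lastCases with
      | last => exact fun h => hzn h.symm
      | cast i => exact hnz i
    have hzB' : z ∈ B := by
      simpa [hzC] using hzB
    have e3 : ∀ i : Fin m,
        (g ∘ Equiv.swap z (C (Fin.last m))) (C i.castSucc) = g (C i.castSucc) := by
      intro i
      rw [Function.comp_apply, Equiv.swap_apply_of_ne_of_ne (hzC _)
        (fun h => (Fin.castSucc_lt_last i).ne (hC h))]
    have := aux _ (g ∘ Equiv.swap z (C (Fin.last m))) (AS0_act hC has hzC) (hkap z hzB')
      (by simpa only [e3] using hinj) (by simpa only [e3] using hr) (by simp [hzg])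
    rw [act_apply] at this
    apply hne
    rw [← this]
    congr 1
    funext a
    simp

lemma vanish (h2 : (2 : F) ≠ 0) {m : ℕ} {hs : List ℕ} (hl : ∀ h ∈ hs, h ≤ m)
    {B : Finset A} {u : Wd F A} {C : Fin (m + 1) → A} (hC : Function.Injective C)
    (hd : ∀ i, C i ∉ B) (hu : u ∈ Ker F ((m + 1) :: hs) (B ∪ univ.image C))
    (has : AS (C ∘ Fin.castSucc) u) (hrho : rho C u = 0)
    (hkap : ∀ z ∈ B, rho C (act (Equiv.swap z (C (Fin.last m))) u) = 0) : u = 0 := by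
  have huW := Ker_le_Wt _ _ hu
  have hl' : ∀ h ∈ (m + 1) :: hs, h ≤ m + 1 := by
    simpa using fun k hk => (hl k hk).trans (Nat.le_succ m)
  have key : ∀ d q : ℕ, q + d = m + 1 → 1 ≤ q → ∀ g : A → ℕ,
      (∀ i j : Fin m, i ≠ j → g (C i.castSucc) ≠ g (C j.castSucc)) →
      (∀ i : Fin m, 1 ≤ g (C i.castSucc) ∧ g (C i.castSucc) ≤ m + 1) →
      (∀ i : Fin m, g (C i.castSucc) ≠ q) → u g = 0 := by
    intro d
    induction d with
    | zero =>
      intro q hq _ g hinj hr hqm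
      refine vanish_top hl hC hd huW has hrho hkap g hinj fun i => ?_
      have h1 := hr i
      have h3 := hqm i
      omega
    | succ d ih =>
      intro q hq hq1 g hinj hr hqm
      have hex : ∃ i : Fin m, g (C i.castSucc) = q + 1 := by
        have himg : univ.image (fun i : Fin m => g (C i.castSucc))
            = (Finset.Icc 1 (m + 1)).erase q := by
          apply Finset.eq_of_subset_of_card_le
          · intro x hx
            obtain ⟨i, _, rfl⟩ := Finset.mem_image.mp hx
            simp [hqm i, hr i]
          · rw [Finset.card_erase_of_mem (by simp; omega), Finset.card_image_of_injective]
            · simp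
            · intro i j hij
              by_contra hne
              exact hinj i j hne hij
        have : q + 1 ∈ (Finset.Icc 1 (m + 1)).erase q := by
          simp
          omega
        rw [← himg] at this
        obtain ⟨i, _, hi⟩ := Finset.mem_image.mp this
        exact ⟨i, hi⟩
      obtain ⟨i0, hi0⟩ := hex
      set a := C i0.castSucc with ha
      have haC : ∀ i : Fin m, i ≠ i0 → C i.castSucc ≠ a := fun i hi h =>
        hi (Fin.castSucc_injective m (hC h))
      have h1 := (mem_Ker.mp hu).2 q hq1 (Function.update g a q)
      have hmem : a ∈ (B ∪ univ.image C).filter (fun b => Function.update g a q b = q) := by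
        simp [ha]
      rw [raise_apply, ← Finset.add_sum_erase _ _ hmem, Finset.sum_eq_zero, add_zero,
        Function.update_idem, ← hi0, Function.update_eq_self] at h1
      · exact h1
      · intro b hb
        rw [Finset.mem_erase, Finset.mem_filter] at hb
        obtain ⟨hba, hbB, hbq⟩ := hb
        rw [Function.update_of_ne hba] at hbq
        have hbC : ∀ i : Fin m, C i.castSucc ≠ b := by
          rintro i rfl
          exact hqm i hbq
        have hval : ∀ i : Fin m, Function.update (Function.update g a q) b (q + 1) (C i.castSucc)
            = if i = i0 then q else g (C i.castSucc) := by
          intro i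
          rw [Function.update_of_ne (hbC i)]
          split_ifs with hi
          · subst hi
            rw [ha, Function.update_self]
          · rw [Function.update_of_ne (haC i hi)]
        apply ih (q + 1) (by omega) (by omega)
        · intro i j hij
          rw [hval, hval]
          split_ifs with hi hj hj
          · exact absurd (hi.trans hj.symm) hij
          · exact (hqm j).symm
          · exact hqm i
          · exact hinj i j hij
        · intro i
          rw [hval]
          split_ifs with hi
          · omega
          · exact hr i
        · intro i
          rw [hval]
          split_ifs with hi
          · omega
          · rw [← hi0]
            exact hinj i i0 hi
  funext g
  by_cases hinj : ∀ i j : Fin m, i ≠ j → g (C i.castSucc) ≠ g (C j.castSucc)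
  · by_cases hr : ∀ i : Fin m, 1 ≤ g (C i.castSucc) ∧ g (C i.castSucc) ≤ m + 1
    · obtain ⟨q, hq, hqm⟩ : ∃ q ∈ Finset.Icc 1 (m + 1),
          q ∉ univ.image (fun i : Fin m => g (C i.castSucc)) := by
        apply Finset.exists_mem_notMem_of_card_lt_card
        refine lt_of_le_of_lt Finset.card_image_le ?_
        simp
      rw [Finset.mem_Icc] at hq
      refine key (m + 1 - q) q (by omega) hq.1 g hinj hr fun i hi => hqm ?_
      exact Finset.mem_image.mpr ⟨i, Finset.mem_univ _, hi⟩
    · rw [not_forall] at hr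
      obtain ⟨i, hi⟩ := hr
      exact Wt.zero_of_range huW hl' (a := C i.castSucc) (by simp) hi
  · push Not at hinj
    obtain ⟨i, j, hij, hg⟩ := hinj
    exact has.zero h2 hij hg

lemma kappa_L (h2 : (2 : F) ≠ 0) {m : ℕ} {hs : List ℕ} (hl : ∀ h ∈ hs, h ≤ m)
    {B : Finset A} {u : Wd F A} {C : Fin (m + 1) → A} (hC : Function.Injective C)
    (hd : ∀ i, C i ∉ B) (hu : u ∈ Wt F ((m + 1) :: hs) (B ∪ univ.image C))
    (has : AS (C ∘ Fin.castSucc) u) {z : A} (hz : z ∈ B) :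
    rho C (act (Equiv.swap z (C (Fin.last m))) (L F (B ∪ univ.image C) (C (Fin.last m)) u))
      = rho C (act (Equiv.swap z (C (Fin.last m))) u)
        + L F B z (rho C (act (Equiv.swap z (C (Fin.last m))) u)) + rho C u := by
  set n := C (Fin.last m) with hn
  have hzC : ∀ i, C i ≠ z := by
    rintro i rfl
    exact hd i hz
  have hne : ∀ i : Fin m, C i.castSucc ≠ n := fun i h =>
    (Fin.castSucc_lt_last i).ne (hC h)
  have hnB : n ∉ B := hd _
  have hset : (B ∪ univ.image C).erase n = B ∪ univ.image (fun i : Fin m => C i.castSucc) := by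
    ext a
    simp only [Finset.mem_erase, Finset.mem_union, Finset.mem_image, Finset.mem_univ, true_and]
    constructor
    · rintro ⟨han, haB | ⟨i, rfl⟩⟩
      · exact Or.inl haB
      · right
        induction i using Fin.lastCases with
        | last => exact absurd rfl han
        | cast i => exact ⟨i, rfl⟩
    · rintro (haB | ⟨i, rfl⟩)
      · refine ⟨?_, Or.inl haB⟩
        rintro rfl
        exact hnB haB
      · exact ⟨hne i, Or.inr ⟨_, rfl⟩⟩
  have hdisj : Disjoint B (univ.image (fun i : Fin m => C i.castSucc)) := by
    rw [Finset.disjoint_right]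
    intro a ha
    obtain ⟨i, _, rfl⟩ := Finset.mem_image.mp ha
    exact hd _
  have hP := P_AS hC has
  rw [← hn] at hP
  have hPW : u - ∑ i : Fin m, act (Equiv.swap (C i.castSucc) n) u
      ∈ Wt F ((m + 1) :: hs) (B ∪ univ.image C) :=
    Submodule.sub_mem _ hu (Submodule.sum_mem _ fun i _ => Wt_act hu (Fix.swap (by simp)
      (by simp [hn])))
  have hP0 := kappa_zero h2 hl hC hd hPW hP hz
  rw [← hn, map_sub, map_sub, sub_eq_zero] at hP0
  rw [L_apply, hset, Finset.sum_union hdisj, Finset.sum_image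
    (fun i _ j _ hij => Fin.castSucc_injective m (hC hij)), map_add, map_add, ← hP0,
    ← Finset.add_sum_erase _ _ hz, map_add, ← act_mul, Equiv.swap_mul_self, act_one, map_add]
  have h3 : rho C (act (Equiv.swap z n) (∑ k ∈ B.erase z, act (Equiv.swap k n) u))
      = L F B z (rho C (act (Equiv.swap z n) u)) := by
    rw [L_apply, map_sum, map_sum]
    apply Finset.sum_congr rfl
    intro k hk
    have hkz := Finset.ne_of_mem_erase hk
    have hkB := Finset.mem_of_mem_erase hk
    have hkn : k ≠ n := by
      rintro rfl
      exact hnB hkB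
    rw [act_conj, Equiv.swap_apply_of_ne_of_ne hkz hkn, Equiv.swap_apply_right, rho_act hC]
    intro i
    apply Equiv.swap_apply_of_ne_of_ne _ (hzC i)
    rintro rfl
    exact hd i hkB
  rw [h3]
  abel

end Core

open Finset
set_option linter.unusedSectionVars false

section Core

variable {F : Type*} [Field F] {A : Type*} [Fintype A] [DecidableEq A]

/-- The equivariant maps considered in the restriction statement. -/
def Eqv (hs : List ℕ) (B : Finset A) (n : A) (ψ : Wd F A →ₗ[F] Wd F A) : Prop :=
  (∀ v ∈ Sp F hs B, ψ v ∈ Ker F hs B) ∧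
    (∀ π, Fix π (B.erase n) → ∀ v ∈ Sp F hs B, ψ (act π v) = act π (ψ v))

lemma Eqv.aeval {hs : List ℕ} {B : Finset A} {n : A} (hn : n ∈ B) (p : Polynomial F) :
    Eqv hs B n (Polynomial.aeval (L F B n) p) :=
  ⟨fun _ hv => Sp_le_Ker _ _ (aeval_mem (fun _ hw => L_mem_Sp hn hw) p hv),
    fun _ hπ v _ => (act_aeval_L hπ p v).symm⟩

lemma Eqv.sub {hs : List ℕ} {B : Finset A} {n : A} {ψ φ : Wd F A →ₗ[F] Wd F A}
    (hψ : Eqv hs B n ψ) (hφ : Eqv hs B n φ) : Eqv hs B n (ψ - φ) :=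
  ⟨fun v hv => Submodule.sub_mem _ (hψ.1 v hv) (hφ.1 v hv), fun π hπ v hv => by
    simp only [LinearMap.sub_apply, map_sub, hψ.2 π hπ v hv, hφ.2 π hπ v hv]⟩

lemma castSucc_mem_erase {m : ℕ} {B : Finset A} {C : Fin (m + 1) → A}
    (hC : Function.Injective C) (i : Fin m) :
    C i.castSucc ∈ (B ∪ univ.image C).erase (C (Fin.last m)) := by
  rw [Finset.mem_erase]
  exact ⟨fun h => (Fin.castSucc_lt_last i).ne (hC h), by simp⟩

lemma Eqv.AS0 {m : ℕ} {hs : List ℕ} {B : Finset A} {C : Fin (m + 1) → A}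
    (hC : Function.Injective C) (hd : ∀ i, C i ∉ B) {ψ : Wd F A →ₗ[F] Wd F A}
    (hψ : Eqv ((m + 1) :: hs) (B ∪ univ.image C) (C (Fin.last m)) ψ) {v : Wd F A}
    (hv : v ∈ Sp F hs B) : AS (C ∘ Fin.castSucc) (ψ (minor C * v)) := by
  intro i j hij
  rw [Function.comp_apply, Function.comp_apply,
    ← hψ.2 _ (Fix.swap (castSucc_mem_erase hC i) (castSucc_mem_erase hC j)) _
      (minor_mul_mem hC hd hv),
    AS_minor_mul hC hd (Sp_le_Wt _ _ hv).1 _ _ (fun h => hij (Fin.castSucc_injective m h)),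
    map_neg]

lemma erase_last_sub {m : ℕ} {B : Finset A} {C : Fin (m + 1) → A} (hd : ∀ i, C i ∉ B) :
    B ⊆ (B ∪ univ.image C).erase (C (Fin.last m)) := by
  intro a ha
  rw [Finset.mem_erase]
  refine ⟨?_, Finset.mem_union_left _ ha⟩
  rintro rfl
  exact hd _ ha

lemma Eqv.scal (h2 : (2 : F) ≠ 0) {m : ℕ} {hs : List ℕ}
    (hsort : hs.Pairwise (fun a b => b ≤ a)) {B : Finset A} {C : Fin (m + 1) → A}
    (hC : Function.Injective C) (hd : ∀ i, C i ∉ B) {ψ : Wd F A →ₗ[F] Wd F A}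
    (hψ : Eqv ((m + 1) :: hs) (B ∪ univ.image C) (C (Fin.last m)) ψ) :
    ∃ a : F, ∀ v ∈ Sp F hs B, rho C (ψ (minor C * v)) = a • v := by
  have hfixC : ∀ π, Fix π B → ∀ i, π (C i) = C i := fun π hπ i => hπ _ (hd i)
  refine schur h2 hs hsort B ((rho C) ∘ₗ ψ ∘ₗ LinearMap.mulLeft F (minor C)) ?_ ?_
  · intro v hv
    exact rho_mem_Wt hC hd (Ker_le_Wt _ _ (hψ.1 _ (minor_mul_mem hC hd hv)))
  · intro π hπ v hv
    simp only [LinearMap.comp_apply, LinearMap.mulLeft_apply]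
    rw [← act_minor_fix (hfixC π hπ), hψ.2 π (hπ.mono (erase_last_sub hd)) _
      (minor_mul_mem hC hd hv), rho_act hC _ _ (hfixC π hπ)]

lemma achieve (h2 : (2 : F) ≠ 0) {m : ℕ} {hs : List ℕ} (hl : ∀ h ∈ hs, h ≤ m)
    (hsort : hs.Pairwise (fun a b => b ≤ a)) {B : Finset A} {C : Fin (m + 1) → A}
    (hC : Function.Injective C) (hd : ∀ i, C i ∉ B) {z : A} (hz : z ∈ B) (p : Polynomial F) :
    ∃ Q : Polynomial F, ∀ v ∈ Sp F hs B,
      rho C (act (Equiv.swap z (C (Fin.last m)))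
        (Polynomial.aeval (L F (B ∪ univ.image C) (C (Fin.last m))) Q (minor C * v)))
        = Polynomial.aeval (L F B z) p v := by
  have hnB : C (Fin.last m) ∈ B ∪ univ.image C := by simp
  have hid : ∀ v ∈ Sp F hs B,
      rho C (act (Equiv.swap z (C (Fin.last m))) (minor C * v)) = 0 := fun v hv =>
    kappa_zero h2 hl hC hd (Sp_le_Wt _ _ (minor_mul_mem hC hd hv))
      (AS_minor_mul hC hd (Sp_le_Wt _ _ hv).1) hz
  have hL1 : ∀ v ∈ Sp F hs B, rho C (act (Equiv.swap z (C (Fin.last m)))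
      (L F (B ∪ univ.image C) (C (Fin.last m)) (minor C * v))) = v := by
    intro v hv
    have has := AS_minor_mul hC hd (Sp_le_Wt _ _ hv).1
    rw [kappa_L h2 hl hC hd (Sp_le_Wt _ _ (minor_mul_mem hC hd hv))
      (fun i j hij => has _ _ (fun h => hij (Fin.castSucc_injective m h))) hz, hid v hv,
      rho_minor_mul hC hd (Sp_le_Wt _ _ hv).1]
    simp
  induction p using Polynomial.induction_on with
  | C c =>
    refine ⟨Polynomial.C c * Polynomial.X, fun v hv => ?_⟩
    simp only [map_mul, Polynomial.aeval_C, Polynomial.aeval_X, Module.End.mul_apply,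
      Module.algebraMap_end_apply, map_smul]
    rw [hL1 v hv]
  | add p q hp hq =>
    obtain ⟨P, hP⟩ := hp
    obtain ⟨Q, hQ⟩ := hq
    refine ⟨P + Q, fun v hv => ?_⟩
    simp only [map_add, LinearMap.add_apply]
    rw [hP v hv, hQ v hv]
  | monomial k c hp =>
    obtain ⟨Q, hQ⟩ := hp
    obtain ⟨a, ha⟩ := Eqv.scal h2 hsort hC hd (Eqv.aeval hnB Q)
    refine ⟨Polynomial.X * Q - Q - Polynomial.C a * Polynomial.X, fun v hv => ?_⟩
    have e : (Polynomial.C c * Polynomial.X ^ (k + 1) : Polynomial F)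
        = Polynomial.X * (Polynomial.C c * Polynomial.X ^ k) := by ring
    rw [e]
    generalize hpp : (Polynomial.C c * Polynomial.X ^ k : Polynomial F) = p1 at *
    simp only [map_sub, map_mul, Polynomial.aeval_C, Polynomial.aeval_X, Module.End.mul_apply,
      Module.algebraMap_end_apply, map_smul, LinearMap.sub_apply]
    rw [hL1 v hv, kappa_L h2 hl hC hd
      (Ker_le_Wt _ _ ((Eqv.aeval hnB Q).1 _ (minor_mul_mem hC hd hv)))
      ((Eqv.aeval hnB Q).AS0 hC hd hv) hz, hQ v hv, ha v hv]
    abel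

/-- Reduction to generators whose first column ends in `n`. -/
lemma Sp_cons_ext_mem (h2 : (2 : F) ≠ 0) {m : ℕ} {hs : List ℕ} (hl : ∀ h ∈ hs, h ≤ m + 1)
    {B : Finset A} {n : A} (hn : n ∈ B) {f g : Wd F A →ₗ[F] Wd F A}
    (H : ∀ (C : Fin (m + 1) → A) (B' : Finset A), Function.Injective C → (∀ i, C i ∉ B') →
      B = B' ∪ univ.image C → C (Fin.last m) = n →
      ∀ v ∈ Sp F hs B', f (minor C * v) = g (minor C * v)) :
    ∀ v ∈ Sp F ((m + 1) :: hs) B, f v = g v := by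
  have H1 : ∀ (C : Fin (m + 1) → A) (B' : Finset A), Function.Injective C → (∀ i, C i ∉ B') →
      B = B' ∪ univ.image C → (∃ j, C j = n) →
      ∀ v ∈ Sp F hs B', f (minor C * v) = g (minor C * v) := by
    rintro C B' hC hd hB ⟨j, hj⟩ v hv
    have := H (C ∘ Equiv.swap j (Fin.last m)) B' (hC.comp (Equiv.injective _))
      (fun i => hd _) (by
        rw [hB, ← Finset.image_image]
        congr 2
        exact (Finset.image_univ_equiv _).symm) (by simp [hj]) v hv
    rw [minor_comp_perm, smul_mul_assoc, map_smul, map_smul] at this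
    rcases Int.units_eq_one_or (Equiv.Perm.sign (Equiv.swap j (Fin.last m))) with h | h <;>
      rw [h] at this <;> simpa using this
  refine Sp_cons_ext fun C B' hC hd hB v hv => ?_
  by_cases hnC : ∃ j, C j = n
  · exact H1 C B' hC hd hB hnC v hv
  · push Not at hnC
    subst hB
    have hg := garnir h2 (l := m + 1) (hs := (m + 1) :: hs) (by simpa using hl)
      (Sp_le_Wt _ _ (minor_mul_mem hC hd hv)) hC (by simp)
      (AS_minor_mul hC hd (Sp_le_Wt _ _ hv).1) hn hnC
    rw [hg, map_sum, map_sum]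
    apply Finset.sum_congr rfl
    intro i _
    have hfix : Fix (Equiv.swap (C i) n) (B' ∪ univ.image C) := Fix.swap (by simp) hn
    rw [act_prod, act_minor]
    apply H1 _ (B'.image (Equiv.swap (C i) n)) ((Equiv.injective _).comp hC)
    · intro k hk
      obtain ⟨a, ha, hak⟩ := Finset.mem_image.mp hk
      rw [Function.comp_apply] at hak
      rw [(Equiv.swap (C i) n).injective hak] at ha
      exact hd k ha
    · rw [← Finset.image_image, ← Finset.image_union, hfix.image]
    · exact ⟨i, by simp⟩
    · have : Sp F hs B' ≤ (Sp F hs (B'.image (Equiv.swap (C i) n))).comap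
          (act (Equiv.swap (C i) n)) :=
        Submodule.span_le.mpr fun p hp => Submodule.subset_span (hp.act _)
      exact this hv

lemma res_caseII (h2 : (2 : F) ≠ 0) {m : ℕ} {hs : List ℕ} (hl : ∀ h ∈ hs, h ≤ m)
    (hsort : hs.Pairwise (fun a b => b ≤ a)) (ih : ResP F A hs) :
    ResP F A ((m + 1) :: hs) := by
  intro B n hn ψ hψ1 hψ2
  have hψ : Eqv ((m + 1) :: hs) B n ψ := ⟨hψ1, hψ2⟩
  have hl1 : ∀ h ∈ hs, h ≤ m + 1 := fun k hk => (hl k hk).trans (Nat.le_succ m)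
  rcases Sp_cons_cases (F := F) (h := m + 1) hs B with hbot | ⟨C0, B0, hC0, hd0, hB0⟩
  · refine ⟨0, fun v hv => ?_⟩
    rw [hbot] at hv
    rw [(Submodule.mem_bot F).mp hv]
    simp
  obtain ⟨C, B', hC, hd, hB, hCn⟩ : ∃ (C : Fin (m + 1) → A) (B' : Finset A),
      Function.Injective C ∧ (∀ i, C i ∉ B') ∧ B = B' ∪ univ.image C ∧ C (Fin.last m) = n := by
    have hfix : Fix (Equiv.swap (C0 (Fin.last m)) n) B := Fix.swap (by rw [hB0]; simp) hn
    refine ⟨Equiv.swap (C0 (Fin.last m)) n ∘ C0, B0.image (Equiv.swap (C0 (Fin.last m)) n),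
      (Equiv.injective _).comp hC0, ?_, ?_, by simp⟩
    · intro k hk
      obtain ⟨a, ha, hak⟩ := Finset.mem_image.mp hk
      rw [Function.comp_apply] at hak
      rw [(Equiv.swap (C0 (Fin.last m)) n).injective hak] at ha
      exact hd0 k ha
    · rw [← Finset.image_image, ← Finset.image_union, ← hB0, hfix.image]
  subst hB hCn
  set n := C (Fin.last m) with hn_def
  have hfixC : ∀ π, Fix π B' → ∀ i, π (C i) = C i := fun π hπ i => hπ _ (hd i)
  -- it suffices to match all the data
  suffices hQ : ∃ Q : Polynomial F, ∀ v ∈ Sp F hs B',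
      ψ (minor C * v) = Polynomial.aeval (L F (B' ∪ univ.image C) n) Q (minor C * v) by
    obtain ⟨Q, hQ⟩ := hQ
    refine ⟨Q, Sp_cons_ext_mem h2 hl1 hn ?_⟩
    intro C1 B1 hC1 hd1 hB1 hC1n v hv
    obtain ⟨π, hπ, hπC⟩ := exists_perm (B := (B' ∪ univ.image C).erase n)
      (hC.comp (Fin.castSucc_injective m)) (hC1.comp (Fin.castSucc_injective m))
      (fun i => castSucc_mem_erase hC i) (fun i => by
        rw [hB1, ← hC1n]
        exact castSucc_mem_erase hC1 i)
    have hπC' : ∀ i, π (C i) = C1 i := by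
      intro i
      induction i using Fin.lastCases with
      | last => rw [← hn_def, hπ n (by simp), hC1n]
      | cast i => exact hπC i
    have hπ' := hπ.mono (Finset.erase_subset _ _)
    obtain ⟨v', hv', hvv⟩ := transfer hd hd1 hB1 hπ' hπC' hv
    have := hψ2 π hπ _ (minor_mul_mem hC hd hv')
    rw [hQ v' hv', act_aeval_L hπ, ← hvv] at this
    exact this
  obtain ⟨a, ha⟩ := Eqv.scal h2 hsort hC hd hψ
  -- a polynomial matching the kappa data
  obtain ⟨Q, hQ⟩ : ∃ Q : Polynomial F, ∀ z ∈ B', ∀ v ∈ Sp F hs B',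
      rho C (act (Equiv.swap z n) (ψ (minor C * v)
        - Polynomial.aeval (L F (B' ∪ univ.image C) n) Q (minor C * v))) = 0 := by
    by_cases hE : ∃ z0, z0 ∈ B'
    swap
    · exact ⟨0, fun z hz => absurd ⟨z, hz⟩ hE⟩
    obtain ⟨z0, hz0⟩ := hE
    have hz0C : ∀ i, C i ≠ z0 := by
      rintro i rfl
      exact hd i hz0
    obtain ⟨p, hp⟩ := ih B' z0 hz0
      ((rho C) ∘ₗ (act (Equiv.swap z0 n)) ∘ₗ ψ ∘ₗ LinearMap.mulLeft F (minor C))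
      (by
        intro v hv
        have hmem := minor_mul_mem hC hd hv
        exact rho_mem_Ker2 h2 hl hC hd (Ker_act (hψ1 _ hmem)
          (Fix.swap (Finset.mem_union_left _ hz0) hn)) (AS0_act hC (hψ.AS0 hC hd hv) hz0C))
      (by
        intro π hπ v hv
        have hπB := hπ.mono (Finset.erase_subset _ _)
        simp only [LinearMap.comp_apply, LinearMap.mulLeft_apply]
        rw [← act_minor_fix (hfixC π hπB), hψ2 π (hπB.mono (erase_last_sub hd)) _
          (minor_mul_mem hC hd hv), ← rho_act hC _ _ (hfixC π hπB), act_conj π,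
          hπ z0 (by simp), hfixC π hπB])
    simp only [LinearMap.comp_apply, LinearMap.mulLeft_apply] at hp
    obtain ⟨Q, hQ⟩ := achieve h2 hl hsort hC hd hz0 p
    refine ⟨Q, ?_⟩
    have hφ := hψ.sub (Eqv.aeval hn Q)
    have hz0case : ∀ v ∈ Sp F hs B',
      rho C (act (Equiv.swap z0 n) (ψ (minor C * v)
        - Polynomial.aeval (L F (B' ∪ univ.image C) n) Q (minor C * v))) = 0 := by
      intro v hv
      rw [map_sub, map_sub, hp v hv, hQ v hv, sub_self]
    intro z hz v hv
    have hτ : Fix (Equiv.swap z z0) B' := Fix.swap hz hz0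
    have h3 := hz0case (act (Equiv.swap z z0) v) (Sp_act hv hτ)
    have h4 := hφ.2 _ (hτ.mono (erase_last_sub hd)) _ (minor_mul_mem hC hd hv)
    rw [act_minor_fix (hfixC _ hτ), LinearMap.sub_apply, LinearMap.sub_apply] at h4
    rw [h4] at h3
    have h5 := congrArg (act (Equiv.swap z z0)) h3
    rw [← rho_act hC _ _ (hfixC _ hτ), act_conj (Equiv.swap z z0), Equiv.swap_apply_right,
      hfixC _ hτ, ← act_mul (Equiv.swap z z0), Equiv.swap_mul_self, act_one, map_zero] at h5
    exact h5
  obtain ⟨b, hb⟩ := Eqv.scal h2 hsort hC hd (Eqv.aeval (hs := (m + 1) :: hs) hn Q)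
  refine ⟨Q + Polynomial.C (a - b), fun v hv => ?_⟩
  have hφ := hψ.sub (Eqv.aeval (hs := (m + 1) :: hs) hn (Q + Polynomial.C (a - b)))
  have hmem := minor_mul_mem hC hd hv
  have h0 := vanish h2 hl hC hd (hφ.1 _ hmem) (hφ.AS0 hC hd hv)
    (by
      simp only [LinearMap.sub_apply, map_add, LinearMap.add_apply, map_sub,
        Polynomial.aeval_C, Module.algebraMap_end_apply, map_smul]
      rw [ha v hv, hb v hv, rho_minor_mul hC hd (Sp_le_Wt _ _ hv).1]
      abel)
    (by
      intro z hz
      have h1 := hQ z hz v hv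
      have h3 := kappa_zero h2 hl hC hd (Sp_le_Wt _ _ hmem)
        (AS_minor_mul hC hd (Sp_le_Wt _ _ hv).1) hz
      rw [← hn_def] at h3 ⊢
      rw [LinearMap.sub_apply, map_add, LinearMap.add_apply, ← sub_sub, map_sub, map_sub, h1,
        Polynomial.aeval_C, Module.algebraMap_end_apply, map_smul, map_smul, h3]
      simp)
  rw [LinearMap.sub_apply, sub_eq_zero] at h0
  exact h0

lemma resP (h2 : (2 : F) ≠ 0) : ∀ hs : List ℕ, hs.Pairwise (fun a b => b ≤ a) →
    (∀ h ∈ hs, 0 < h) → ResP F A hs := by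
  intro hs
  induction hs with
  | nil =>
    intro _ _ B n hn ψ _ _
    refine ⟨0, fun v hv => ?_⟩
    have : Sp F [] B ≤ (⊥ : Submodule F (Wd F A)) := by
      refine Submodule.span_le.mpr fun p hp => ?_
      cases hp with
      | nil => simp at hn
    rw [(Submodule.mem_bot F).mp (this hv)]
    simp
  | cons l hs ih =>
    intro hsort hpos
    have hsort' := List.pairwise_cons.mp hsort
    have ih' := ih hsort'.2 (fun h hh => hpos h (by simp [hh]))
    obtain ⟨m, rfl⟩ : ∃ m, l = m + 1 := ⟨l - 1, by have := hpos l (by simp); omega⟩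
    by_cases hc : ∀ h ∈ hs, h ≤ m
    · exact res_caseII h2 hc hsort'.2 ih'
    · cases hs with
      | nil => simp at hc
      | cons k hs =>
        have hs2 := List.pairwise_cons.mp hsort'.2
        have : k = m + 1 := by
          have h1 := hsort'.1 k (by simp)
          by_contra hne
          apply hc
          intro h hh
          rcases List.mem_cons.mp hh with rfl | hh
          · omega
          · have := hs2.1 h hh
            omega
        subst this
        exact res_caseI h2 hs2.1 ih'

end Core

open Finset
set_option linter.unusedSectionVars false

section Bridge

variable {F : Type*} [Field F]

section GenRel

variable {A : Type*} [Fintype A] [DecidableEq A]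

lemma image_of_union {h : ℕ} {B0 B1 : Finset A} {C0 C1 : Fin h → A}
    (hd0 : ∀ i, C0 i ∉ B0) (hd1 : ∀ i, C1 i ∉ B1)
    (hB : B0 ∪ univ.image C0 = B1 ∪ univ.image C1) {π : Equiv.Perm A}
    (hπ : Fix π (B0 ∪ univ.image C0)) (hπC : ∀ i, π (C0 i) = C1 i) : B0.image π = B1 := by
  have e0 : B0 = (B0 ∪ univ.image C0) \ univ.image C0 := by
    rw [Finset.union_sdiff_cancel_right]
    rw [Finset.disjoint_right]
    intro a ha
    obtain ⟨i, _, rfl⟩ := Finset.mem_image.mp ha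
    exact hd0 i
  have e1 : B1 = (B1 ∪ univ.image C1) \ univ.image C1 := by
    rw [Finset.union_sdiff_cancel_right]
    rw [Finset.disjoint_right]
    intro a ha
    obtain ⟨i, _, rfl⟩ := Finset.mem_image.mp ha
    exact hd1 i
  have e2 : univ.image C1 = (univ.image C0).image π := by
    rw [Finset.image_image]
    congr 1
    funext i
    exact (hπC i).symm
  rw [e0, Finset.image_sdiff _ _ π.injective, hπ.image, ← e2, hB, ← e1]

lemma Gen.rel {hs : List ℕ} : ∀ {B : Finset A} {p q : Wd F A}, Gen F hs B p → Gen F hs B q →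
    ∃ π : Equiv.Perm A, Fix π B ∧ q = CarterPayne.act π p := by
  induction hs with
  | nil =>
    intro B p q hp hq
    cases hp
    cases hq
    exact ⟨1, fun _ _ => rfl, rfl⟩
  | cons h hs ih =>
    intro B p q hp hq
    cases hp with
    | cons C hC hd hB hp =>
      cases hq with
      | cons C1 hC1 hd1 hB1 hq =>
        subst hB
        obtain ⟨π, hπ, hπC⟩ := exists_perm hC hC1
          (fun i => Finset.mem_union_right _ (Finset.mem_image_of_mem _ (Finset.mem_univ i)))
          (fun i => by
            rw [hB1]
            exact Finset.mem_union_right _ (Finset.mem_image_of_mem _ (Finset.mem_univ i)))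
        have hp' := hp.act π
        rw [image_of_union hd hd1 hB1 hπ hπC] at hp'
        obtain ⟨τ, hτ, hqq⟩ := ih hp' hq
        refine ⟨τ * π, ?_, ?_⟩
        · refine Fix.mul ?_ hπ
          rw [hB1]
          exact hτ.mono Finset.subset_union_left
        · rw [hqq, act_mul, act_prod, act_prod, act_minor, act_minor]
          congr 2
          funext i
          simp only [Function.comp_apply]
          rw [hπC, hτ _ (hd1 i)]

/-- A function which is antisymmetric under all columns and normalized is a generator. -/
lemma Gen.of_AS (h2 : (2 : F) ≠ 0) (ht : ℕ → ℕ) (ci : A → ℕ) (g0 : A → ℕ) :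
    ∀ (cs : List ℕ), cs.Nodup → cs.Pairwise (fun a b => ht b ≤ ht a) →
    ∀ (col : ∀ c, Fin (ht c) → A),
    (∀ c ∈ cs, Function.Injective (col c) ∧ (∀ i, g0 (col c i) = i + 1) ∧
      (∀ a, ci a = c ↔ ∃ i, col c i = a)) →
    ∀ (u : Wd F A), u ∈ Wt F (cs.map ht) (univ.filter fun a => ci a ∈ cs) → u g0 = 1 →
    (∀ c ∈ cs, AS (col c) u) → Gen F (cs.map ht) (univ.filter fun a => ci a ∈ cs) u := by
  intro cs
  induction cs with
  | nil =>
    intro _ _ col _ u hu hug _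
    have h1 : u = 1 := by
      funext g
      rw [hu.1 g g0 (by simp), hug]
      rfl
    subst h1
    simpa using Gen.nil (F := F) (A := A)
  | cons c cs ih =>
    intro hnd hsort col hcol u hu hug has
    rw [List.nodup_cons] at hnd
    rw [List.pairwise_cons] at hsort
    obtain ⟨hC, hg0, hci⟩ := hcol c (by simp)
    have hB : (univ.filter fun a => ci a ∈ c :: cs)
        = (univ.filter fun a => ci a ∈ cs) ∪ univ.image (col c) := by
      ext a
      simp only [Finset.mem_filter, Finset.mem_univ, true_and, Finset.mem_union,
        Finset.mem_image, List.mem_cons, hci]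
      tauto
    have hd : ∀ i, col c i ∉ (univ.filter fun a => ci a ∈ cs) := by
      intro i hi
      rw [Finset.mem_filter, (hci _).mpr ⟨i, rfl⟩] at hi
      exact hnd.1 hi.2
    rw [List.map_cons] at hu ⊢
    have hdiv := div_minor h2 hu (by
      intro k hk
      obtain ⟨b, hb, rfl⟩ := List.mem_map.mp hk
      exact hsort.1 b hb) hC (fun i => by rw [hB]; simp) (has c (by simp))
    rw [hdiv]
    refine Gen.cons (col c) hC hd hB (ih hnd.2 hsort.2 col (fun d hd => hcol d (by simp [hd]))
      _ ?_ ?_ ?_)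
    · rw [hB] at hu
      exact rho_mem_Wt hC hd hu
    · rw [rho_apply, ← hug]
      congr 1
      funext a
      by_cases ha : ∃ i, col c i = a
      · obtain ⟨i, rfl⟩ := ha
        rw [ov_mem hC, hg0]
      · push Not at ha
        rw [ov_not _ ha]
    · intro d hdc i j hij
      rw [← rho_act hC, has d (by simp [hdc]) i j hij, map_neg]
      intro k
      have hkd : ∀ i, col c k ≠ col d i := by
        intro i h
        have h1 : ci (col c k) = c := (hci _).mpr ⟨k, rfl⟩
        have h3 : ci (col d i) = d := ((hcol d (by simp [hdc])).2.2 _).mpr ⟨i, rfl⟩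
        rw [h, h3] at h1
        rw [h1] at hdc
        exact hnd.1 hdc
      exact Equiv.swap_apply_of_ne_of_ne (hkd i) (hkd j)

end GenRel

variable {n : ℕ}

open Classical in
/-- Embedding of the permutation module into functions on words. -/
noncomputable def J (F : Type*) [Field F] {n : ℕ} (c : ℕ → ℕ) :
    PermMod F n c →ₗ[F] Wd F (Fin n) where
  toFun v g := if h : ∀ i, (Finset.univ.filter fun k => g k = i).card = c i then v ⟨g, h⟩ else 0
  map_add' u v := by
    funext g
    by_cases h : ∀ i, (Finset.univ.filter fun k => g k = i).card = c i
    · simp only [dif_pos h, Pi.add_apply]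
      rfl
    · simp only [Pi.add_apply, dif_neg h, add_zero]
  map_smul' r v := by
    funext g
    by_cases h : ∀ i, (Finset.univ.filter fun k => g k = i).card = c i
    · simp only [dif_pos h, Pi.smul_apply, RingHom.id_apply]
      rfl
    · simp only [Pi.smul_apply, dif_neg h, smul_zero, RingHom.id_apply]

lemma J_tab {c : ℕ → ℕ} (v : PermMod F n c) (t : Tabloid n c) : J F c v t.1 = v t := by
  simp only [J, LinearMap.coe_mk, AddHom.coe_mk]
  rw [dif_pos t.2]
  rfl

lemma J_ne {c : ℕ → ℕ} {v : PermMod F n c} {g : Fin n → ℕ} (hg : J F c v g ≠ 0) (i : ℕ) :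
    (Finset.univ.filter fun k => g k = i).card = c i := by
  by_contra h
  apply hg
  simp only [J, LinearMap.coe_mk, AddHom.coe_mk]
  rw [dif_neg]
  exact fun h' => h (h' i)

lemma J_inj (c : ℕ → ℕ) : Function.Injective (J F c : PermMod F n c →ₗ[F] Wd F (Fin n)) := by
  intro u v h
  ext t
  rw [← J_tab, h, J_tab]

lemma permTabloid_mul (c : ℕ → ℕ) (π τ : Equiv.Perm (Fin n)) (t : Tabloid n c) :
    permTabloid c (π * τ) t = permTabloid c π (permTabloid c τ t) := rfl

lemma permTabloid_one (c : ℕ → ℕ) (t : Tabloid n c) : permTabloid c 1 t = t := rfl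

lemma permM_single (c : ℕ → ℕ) (π : Equiv.Perm (Fin n)) (t : Tabloid n c) (r : F) :
    permM F c π (Finsupp.single t r) = Finsupp.single (permTabloid c π t) r := by
  simp [permM, Finsupp.mapDomain_single]

lemma permM_mul (c : ℕ → ℕ) (π τ : Equiv.Perm (Fin n)) :
    permM F c (π * τ) = permM F c π * permM F c τ := by
  ext t : 1
  ext
  simp [permM_single, permTabloid_mul]

lemma permM_one (c : ℕ → ℕ) : permM F c (1 : Equiv.Perm (Fin n)) = 1 := by
  ext t : 1
  ext
  simp [permM_single, permTabloid_one]

lemma permM_mul_apply (c : ℕ → ℕ) (π τ : Equiv.Perm (Fin n)) (v : PermMod F n c) :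
    permM F c (π * τ) v = permM F c π (permM F c τ v) := by
  rw [permM_mul]; rfl

lemma permM_one_apply (c : ℕ → ℕ) (v : PermMod F n c) :
    permM F c (1 : Equiv.Perm (Fin n)) v = v := by
  rw [permM_one]; rfl

lemma J_single (c : ℕ → ℕ) (t : Tabloid n c) (r : F) (g : Fin n → ℕ) :
    J F c (Finsupp.single t r) g = if t.1 = g then r else 0 := by
  classical
  by_cases h : ∀ i, (Finset.univ.filter fun k => g k = i).card = c i
  · obtain ⟨s, rfl⟩ : ∃ s : Tabloid n c, s.1 = g := ⟨⟨g, h⟩, rfl⟩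
    rw [J_tab, Finsupp.single_apply]
    by_cases hts : t = s
    · rw [if_pos hts, if_pos (by rw [hts])]
    · rw [if_neg hts, if_neg (fun h' => hts (Subtype.ext h'))]
  · have h1 : J F c (Finsupp.single t r) g = 0 := by
      by_contra hne
      exact h (J_ne hne)
    rw [h1, if_neg]
    rintro rfl
    exact h t.2

lemma J_permM (c : ℕ → ℕ) (π : Equiv.Perm (Fin n)) (v : PermMod F n c) :
    J F c (permM F c π v) = act π (J F c v) := by
  induction v using Finsupp.induction_linear with
  | zero => simp
  | add u v hu hv => rw [map_add, map_add, hu, hv, map_add, map_add]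
  | single t r =>
    funext g
    rw [permM_single, J_single, act_apply, J_single]
    congr 1
    rw [eq_iff_iff]
    constructor
    · intro h
      rw [← h]
      funext k
      simp [permTabloid]
    · intro h
      funext k
      simp [permTabloid, h]

/-- Moving a placement by a permutation. -/
def Placement.mv {μ : Partition n} (T : Placement μ) (π : Equiv.Perm (Fin n)) : Placement μ where
  pos k := T.pos (π⁻¹ k)
  mem k := T.mem _
  inj := T.inj.comp (Equiv.injective _)
  surj c hc := by
    obtain ⟨k, hk⟩ := T.surj c hc
    exact ⟨π k, by simpa using hk⟩

lemma permM_poly {μ : Partition n} (T : Placement μ) (π : Equiv.Perm (Fin n)) :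
    permM F μ.parts π (polytabloid F T) = polytabloid F (T.mv π) := by
  rw [polytabloid, polytabloid, map_sum]
  apply Finset.sum_equiv (MulAut.conj π).toEquiv
  · intro σ
    rw [colStab, colStab, Finset.mem_filter, Finset.mem_filter]
    simp only [Finset.mem_univ, true_and]
    constructor
    · intro h k
      simpa [Placement.mv] using h (π⁻¹ k)
    · intro h k
      simpa [Placement.mv] using h (π k)
  · intro σ _
    rw [map_smul, permM_single]
    congr 2
    · rcases Int.units_eq_one_or (Equiv.Perm.sign π) with h | h <;> simp [h]
    · apply Subtype.ext
      funext k
      simp [permTabloid, rowTabloid, Placement.mv]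

lemma Specht_perm {μ : Partition n} (π : Equiv.Perm (Fin n)) {v : PermMod F n μ.parts}
    (hv : v ∈ Specht F μ) : permM F μ.parts π v ∈ Specht F μ := by
  have : Specht F μ ≤ (Specht F μ).comap (permM F μ.parts π) := by
    refine Submodule.span_le.mpr ?_
    rintro _ ⟨T, rfl⟩
    refine Submodule.subset_span ⟨T.mv π, ?_⟩
    exact (permM_poly T π).symm
  exact this hv

lemma permM_poly_col {μ : Partition n} (T : Placement μ) {π : Equiv.Perm (Fin n)}
    (hπ : π ∈ colStab T) : permM F μ.parts π (polytabloid F T)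
      = ((Equiv.Perm.sign π : ℤ) : F) • polytabloid F T := by
  rw [polytabloid, map_sum, Finset.smul_sum]
  have hπ' : ∀ k, (T.pos (π⁻¹ k)).2 = (T.pos k).2 := by
    intro k
    simp only [colStab, Finset.mem_filter, Finset.mem_univ, true_and] at hπ
    have := hπ (π⁻¹ k)
    simpa using this.symm
  apply Finset.sum_equiv (Equiv.mulRight π⁻¹)
  · intro σ
    simp only [colStab, Finset.mem_filter, Finset.mem_univ, true_and, Equiv.coe_mulRight,
      Equiv.Perm.mul_apply]
    constructor
    · intro h k
      rw [h, hπ']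
    · intro h k
      have h1 := h (π k)
      have h3 := hπ' (π k)
      simp only [Equiv.Perm.coe_inv, Equiv.symm_apply_apply] at h1 h3
      rw [h1, h3]
  · intro σ _
    rw [map_smul, permM_single, smul_smul]
    congr 2
    · rw [Equiv.coe_mulRight, Equiv.Perm.sign_mul, Equiv.Perm.sign_inv]
      rcases Int.units_eq_one_or (Equiv.Perm.sign π) with h | h <;> rw [h] <;> simp

lemma J_poly_self {μ : Partition n} (T : Placement μ) :
    J F μ.parts (polytabloid F T) (fun k => (T.pos k).1) = 1 := by
  rw [polytabloid, map_sum, Finset.sum_apply, Finset.sum_eq_single 1]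
  · rw [map_smul, Pi.smul_apply, J_single,
      if_pos (show (rowTabloid T 1).1 = fun k => (T.pos k).1 from rfl)]
    simp
  · intro σ hσ hne
    rw [map_smul, Pi.smul_apply, J_single, if_neg, smul_zero]
    intro h
    apply hne
    ext k
    simp only [colStab, Finset.mem_filter, Finset.mem_univ, true_and] at hσ
    have := T.inj (Prod.ext (congrFun h k) (hσ k))
    rw [this]
    rfl
  · intro h
    exfalso
    apply h
    simp [colStab]

end Bridge

open Finset
set_option linter.unusedSectionVars false

section Bridge2

variable {F : Type*} [Field F] {n : ℕ}

lemma Partition.exists_bd (μ : Partition n) : ∃ N, ∀ i, μ.parts i ≠ 0 → i ≤ N := by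
  obtain ⟨N, hN⟩ := μ.finite_support.bddAbove
  exact ⟨N, fun i hi => hN hi⟩

/-- Column heights. -/
noncomputable def Partition.ht (μ : Partition n) (c : ℕ) : ℕ :=
  Nat.findGreatest (fun i => c < μ.parts i) μ.exists_bd.choose

lemma Partition.le_ht (μ : Partition n) {i : ℕ} (hi : 1 ≤ i) (c : ℕ) :
    i ≤ μ.ht c ↔ c < μ.parts i := by
  constructor
  · intro h
    have h0 : μ.ht c ≠ 0 := by omega
    have h1 : c < μ.parts (μ.ht c) :=
      Nat.findGreatest_of_ne_zero (P := fun i => c < μ.parts i) rfl h0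
    exact lt_of_lt_of_le h1 (μ.antitone (by omega) h)
  · intro h
    exact Nat.le_findGreatest (μ.exists_bd.choose_spec i (by omega)) h

/-- The list of column heights. -/
noncomputable def Partition.hs (μ : Partition n) : List ℕ := (List.range (μ.parts 1)).map μ.ht

lemma Partition.ht_anti (μ : Partition n) {a b : ℕ} (h : a ≤ b) : μ.ht b ≤ μ.ht a := by
  by_contra hlt
  push Not at hlt
  have h1 : 1 ≤ μ.ht b := by omega
  have h2 := (μ.le_ht h1 b).mp le_rfl
  have h3 := (μ.le_ht h1 a).mpr (by omega)
  omega

lemma Partition.range_sort (μ : Partition n) :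
    (List.range (μ.parts 1)).Pairwise (fun a b => μ.ht b ≤ μ.ht a) :=
  List.pairwise_lt_range.imp (fun h => μ.ht_anti h.le)

lemma Partition.hs_sort (μ : Partition n) : μ.hs.Pairwise (fun a b => b ≤ a) := by
  rw [Partition.hs, List.pairwise_map]
  exact μ.range_sort

lemma Partition.hs_pos (μ : Partition n) : ∀ h ∈ μ.hs, 0 < h := by
  intro h hh
  obtain ⟨c, hc, rfl⟩ := List.mem_map.mp hh
  exact (μ.le_ht le_rfl c).mpr (List.mem_range.mp hc)

lemma countP_range (k m : ℕ) : (List.range m).countP (fun c => decide (c < k)) = min m k := by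
  induction m with
  | zero => simp
  | succ m ih =>
    rw [List.range_succ, List.countP_append, ih]
    by_cases h : m < k
    · simp [h]; omega
    · simp [h]; omega

lemma Partition.wt_hs (μ : Partition n) (i : ℕ) : wt μ.hs i = μ.parts i := by
  rw [wt, Partition.hs, List.countP_map]
  rcases Nat.eq_zero_or_pos i with rfl | hi
  · rw [μ.parts_zero, List.countP_eq_zero]
    simp
  · have : ((fun h => decide (1 ≤ i ∧ i ≤ h)) ∘ μ.ht) = fun c => decide (c < μ.parts i) := by
      funext c
      simp only [Function.comp_apply, decide_eq_decide]
      rw [μ.le_ht hi]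
      exact and_iff_right hi
    rw [this, countP_range]
    exact min_eq_right (μ.antitone (by omega) hi)

lemma J_Wt (μ : Partition n) (v : PermMod F n μ.parts) : J F μ.parts v ∈ Wt F μ.hs univ := by
  refine ⟨fun g g' h => ?_, fun g hg i => ?_⟩
  · have : g = g' := funext fun a => h a (Finset.mem_univ a)
    rw [this]
  · rw [μ.wt_hs]
    exact J_ne hg i

lemma J_poly_Gen (h2 : (2 : F) ≠ 0) {μ : Partition n} (T : Placement μ) :
    Gen F μ.hs univ (J F μ.parts (polytabloid F T)) := by
  have hex : ∀ c (i : Fin (μ.ht c)), ∃ k, T.pos k = ((i : ℕ) + 1, c + 1) := by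
    intro c i
    apply T.surj
    refine ⟨Nat.succ_pos _, Nat.succ_pos _, ?_⟩
    exact (μ.le_ht (by omega) c).mp i.2
  choose col hcol using hex
  have hcell : ∀ k, 0 < (T.pos k).1 ∧ 0 < (T.pos k).2 ∧ (T.pos k).2 ≤ μ.parts (T.pos k).1 :=
    fun k => T.mem k
  have huniv : (univ.filter fun a => (T.pos a).2 - 1 ∈ List.range (μ.parts 1)) = univ := by
    rw [Finset.filter_eq_self]
    intro k _
    rw [List.mem_range]
    have h1 := hcell k
    have h3 := μ.antitone (i := 1) (j := (T.pos k).1) one_pos h1.1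
    omega
  have key := Gen.of_AS h2 μ.ht (fun k => (T.pos k).2 - 1) (fun k => (T.pos k).1)
    (List.range (μ.parts 1)) List.nodup_range μ.range_sort col ?_ (J F μ.parts (polytabloid F T))
    ?_ (J_poly_self T) ?_
  · rw [huniv] at key
    exact key
  · intro c _
    refine ⟨?_, ?_, ?_⟩
    · intro i j hij
      have h1 := hcol c i
      rw [hij, hcol c j] at h1
      have := congrArg Prod.fst h1
      simp only at this
      apply Fin.ext
      omega
    · intro i
      simp only [hcol]
    · intro a
      constructor
      · intro h
        have h1 := hcell a
        have h3 : (T.pos a).1 ≤ μ.ht c := (μ.le_ht h1.1 c).mpr (by omega)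
        refine ⟨⟨(T.pos a).1 - 1, by omega⟩, T.inj ?_⟩
        rw [hcol]
        apply Prod.ext
        · simp only; omega
        · simp only; omega
      · rintro ⟨i, rfl⟩
        rw [hcol]
        simp
  · rw [huniv]
    exact J_Wt μ _
  · intro c _ i j hij
    have hne : col c i ≠ col c j := by
      intro h
      have h1 := hcol c i
      rw [h, hcol c j] at h1
      have := congrArg Prod.fst h1
      simp only at this
      apply hij
      apply Fin.ext
      omega
    have hmem : Equiv.swap (col c i) (col c j) ∈ colStab T := by
      rw [colStab, Finset.mem_filter]
      refine ⟨Finset.mem_univ _, fun k => ?_⟩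
      rw [Equiv.swap_apply_def]
      split_ifs with h1 h3
      · rw [h1, hcol, hcol]
      · rw [h3, hcol, hcol]
      · rfl
    rw [← J_permM, permM_poly_col T hmem, Equiv.Perm.sign_swap hne]
    simp

lemma J_Specht_le (h2 : (2 : F) ≠ 0) {μ : Partition n} {v : PermMod F n μ.parts}
    (hv : v ∈ Specht F μ) : J F μ.parts v ∈ Sp F μ.hs univ := by
  have : Specht F μ ≤ (Sp F μ.hs univ).comap (J F μ.parts) := by
    refine Submodule.span_le.mpr ?_
    rintro _ ⟨T, rfl⟩
    exact Submodule.subset_span (J_poly_Gen h2 T)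
  exact this hv

lemma Sp_le_J (h2 : (2 : F) ≠ 0) {μ : Partition n} (T : Placement μ) {w : Wd F (Fin n)}
    (hw : w ∈ Sp F μ.hs univ) : ∃ v ∈ Specht F μ, J F μ.parts v = w := by
  have : Sp F μ.hs univ ≤ (Specht F μ).map (J F μ.parts) := by
    refine Submodule.span_le.mpr ?_
    intro p hp
    obtain ⟨π, _, rfl⟩ := Gen.rel (J_poly_Gen h2 T) hp
    refine ⟨permM F μ.parts π (polytabloid F T), ?_, J_permM _ _ _⟩
    exact Specht_perm π (Submodule.subset_span ⟨T, rfl⟩)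
  exact this hw

lemma Specht_bot {μ : Partition n} (h : IsEmpty (Placement μ)) {v : PermMod F n μ.parts}
    (hv : v ∈ Specht F μ) : v = 0 := by
  rw [Specht, Set.range_eq_empty, Submodule.span_empty] at hv
  exact hv

/-- Transfer of an endomorphism of the Specht module to functions on words. -/
lemma exists_transfer {μ : Partition n} (Φ : Module.End F ↥(Specht F μ)) :
    ∃ ψ : Wd F (Fin n) →ₗ[F] Wd F (Fin n), ∀ x : ↥(Specht F μ),
      ψ (J F μ.parts x) = J F μ.parts (Φ x) := by
  let f : ↥(Specht F μ) →ₗ[F] Wd F (Fin n) := (J F μ.parts).domRestrict (Specht F μ)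
  have hf : LinearMap.ker f = ⊥ := by
    rw [eq_bot_iff]
    intro x hx
    have h1 : J F μ.parts (x : PermMod F n μ.parts) = J F μ.parts 0 := by
      rw [map_zero]
      exact hx
    exact Subtype.ext (J_inj μ.parts h1)
  obtain ⟨K, hK⟩ := LinearMap.exists_leftInverse_of_injective
    (V := ↥(Specht F μ)) (V' := Wd F (Fin n)) f hf
  refine ⟨f ∘ₗ Φ ∘ₗ K, fun x => ?_⟩
  have h1 : K (J F μ.parts x) = x := LinearMap.congr_fun hK x
  simp only [LinearMap.comp_apply, h1]
  rfl

theorem schur_Specht (h2 : (2 : F) ≠ 0) (μ : Partition n) (Φ : Module.End F ↥(Specht F μ))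
    (hΦ : ∀ π : Equiv.Perm (Fin n), ∀ x y : ↥(Specht F μ),
      (x : PermMod F n μ.parts) = permM F μ.parts π y →
      (Φ x : PermMod F n μ.parts) = permM F μ.parts π (Φ y)) :
    ∃ a : F, ∀ x, Φ x = a • x := by
  rcases isEmpty_or_nonempty (Placement μ) with hE | ⟨⟨T⟩⟩
  · refine ⟨0, fun x => Subtype.ext ?_⟩
    rw [Specht_bot hE (Φ x).2, Specht_bot hE ((0 : F) • x).2]
  · obtain ⟨ψ, hψ⟩ := exists_transfer Φ
    obtain ⟨a, ha⟩ := schur h2 μ.hs μ.hs_sort univ ψ (fun w hw => by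
        obtain ⟨v, hv, rfl⟩ := Sp_le_J h2 T hw
        rw [hψ ⟨v, hv⟩]
        exact J_Wt μ _) (fun π _ w hw => by
        obtain ⟨v, hv, rfl⟩ := Sp_le_J h2 T hw
        rw [hψ ⟨v, hv⟩, ← J_permM, hψ ⟨_, Specht_perm π hv⟩, ← J_permM]
        congr 1
        exact hΦ π _ _ rfl)
    refine ⟨a, fun x => Subtype.ext (J_inj μ.parts ?_)⟩
    rw [← hψ, ha _ (J_Specht_le h2 x.2)]
    simp

/-- The Jucys–Murphy type element on the permutation module. -/
noncomputable def LS (F : Type*) [Field F] (c : ℕ → ℕ) (e : Fin n) : Module.End F (PermMod F n c) :=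
  ∑ k ∈ univ.erase e, permM F c (Equiv.swap k e)

lemma LS_apply (c : ℕ → ℕ) (e : Fin n) (v : PermMod F n c) :
    LS F c e v = ∑ k ∈ univ.erase e, permM F c (Equiv.swap k e) v := by
  simp [LS]

lemma J_LS (c : ℕ → ℕ) (e : Fin n) (v : PermMod F n c) :
    J F c (LS F c e v) = L F univ e (J F c v) := by
  rw [LS_apply, L_apply, map_sum]
  exact Finset.sum_congr rfl fun k _ => J_permM _ _ _

theorem res_Specht (h2 : (2 : F) ≠ 0) (μ : Partition n) (e : Fin n)
    (Φ : Module.End F ↥(Specht F μ)) (hΦ : Φ ∈ EndResAt F μ e) :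
    ∃ p : Polynomial F, ∀ x : ↥(Specht F μ),
      (Φ x : PermMod F n μ.parts) = Polynomial.aeval (LS F μ.parts e) p (x : PermMod F n μ.parts) := by
  rcases isEmpty_or_nonempty (Placement μ) with hE | ⟨⟨T⟩⟩
  · refine ⟨0, fun x => ?_⟩
    rw [Specht_bot hE (Φ x).2, map_zero, LinearMap.zero_apply]
  · obtain ⟨ψ, hψ⟩ := exists_transfer Φ
    obtain ⟨p, hp⟩ := resP h2 μ.hs μ.hs_sort μ.hs_pos univ e (Finset.mem_univ e) ψ (fun w hw => by
        obtain ⟨v, hv, rfl⟩ := Sp_le_J h2 T hw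
        rw [hψ ⟨v, hv⟩]
        exact Sp_le_Ker _ _ (J_Specht_le h2 (Φ _).2)) (fun π hπ w hw => by
        obtain ⟨v, hv, rfl⟩ := Sp_le_J h2 T hw
        rw [hψ ⟨v, hv⟩, ← J_permM, hψ ⟨_, Specht_perm π hv⟩, ← J_permM]
        congr 1
        exact hΦ π (hπ e (by simp)) _ _ rfl)
    refine ⟨p, fun x => J_inj μ.parts ?_⟩
    rw [← hψ, hp _ (J_Specht_le h2 x.2)]
    exact (aeval_comm (S := ⊤) (fun _ _ => Submodule.mem_top) (fun v _ => J_LS _ _ v) p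
      Submodule.mem_top).symm

end Bridge2

open Finset
set_option linter.unusedSectionVars false

section Final1

variable {F : Type*} [Field F] {n : ℕ}

lemma IsSwap_conj {A : Type*} [DecidableEq A] (π g : Equiv.Perm A) :
    (π * g * π⁻¹).IsSwap ↔ g.IsSwap := by
  have key : ∀ (π g : Equiv.Perm A), g.IsSwap → (π * g * π⁻¹).IsSwap := by
    rintro π g ⟨x, y, hxy, rfl⟩
    exact ⟨π x, π y, fun h => hxy (π.injective h), by rw [Equiv.swap_apply_apply]⟩
  constructor
  · intro h
    have := key π⁻¹ _ h
    simpa [mul_assoc] using this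
  · exact key π g

open Classical in
lemma sum_swaps {A : Type*} [Fintype A] [DecidableEq A] {V : Type*} [AddCommMonoid V]
    (e : A) (f : Equiv.Perm A → V) :
    ∑ g ∈ univ.filter (fun g : Equiv.Perm A => g.IsSwap), f g
      = ∑ g ∈ univ.filter (fun g : Equiv.Perm A => g.IsSwap ∧ g e = e), f g
        + ∑ k ∈ univ.erase e, f (Equiv.swap k e) := by
  rw [← Finset.sum_filter_add_sum_filter_not (univ.filter (fun g : Equiv.Perm A => g.IsSwap))
    (fun g => g e = e), Finset.filter_filter, Finset.filter_filter]
  congr 1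
  symm
  apply Finset.sum_bij (fun k _ => Equiv.swap k e)
  · intro k hk
    have hk' : k ≠ e := Finset.ne_of_mem_erase hk
    rw [Finset.mem_filter]
    refine ⟨Finset.mem_univ _, ⟨k, e, hk', rfl⟩, ?_⟩
    rw [Equiv.swap_apply_right]
    exact hk'
  · intro a _ b _ hab
    have := congrArg (fun g : Equiv.Perm A => g e) hab
    simpa using this
  · intro g hg
    rw [Finset.mem_filter] at hg
    obtain ⟨_, ⟨x, y, hxy, rfl⟩, hne⟩ := hg
    rcases eq_or_ne e x with rfl | hx
    · exact ⟨y, Finset.mem_erase.mpr ⟨hxy.symm, Finset.mem_univ _⟩, Equiv.swap_comm _ _⟩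
    rcases eq_or_ne e y with rfl | hy
    · exact ⟨x, Finset.mem_erase.mpr ⟨hxy, Finset.mem_univ _⟩, rfl⟩
    exact absurd (Equiv.swap_apply_of_ne_of_ne hx hy) hne
  · intro a _
    rfl

open Classical in
/-- The sum of all transpositions on the permutation module. -/
noncomputable def Etot (F : Type*) [Field F] (c : ℕ → ℕ) : Module.End F (PermMod F n c) :=
  ∑ g ∈ univ.filter (fun g : Equiv.Perm (Fin n) => g.IsSwap), permM F c g

open Classical in
lemma Etot_apply (c : ℕ → ℕ) (v : PermMod F n c) : Etot F c v
    = ∑ g ∈ univ.filter (fun g : Equiv.Perm (Fin n) => g.IsSwap), permM F c g v := by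
  rw [Etot, LinearMap.sum_apply]

lemma Etot_perm (c : ℕ → ℕ) (π : Equiv.Perm (Fin n)) (v : PermMod F n c) :
    Etot F c (permM F c π v) = permM F c π (Etot F c v) := by
  classical
  rw [Etot_apply, Etot_apply, map_sum]
  symm
  apply Finset.sum_equiv (MulAut.conj π).toEquiv
  · intro g
    rw [Finset.mem_filter, Finset.mem_filter]
    simp only [Finset.mem_univ, true_and]
    exact (IsSwap_conj π g).symm
  · intro g _
    rw [← permM_mul_apply, ← permM_mul_apply]
    congr 2
    simp

theorem Etot_scalar (h2 : (2 : F) ≠ 0) (μ : Partition n) :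
    ∃ a : F, ∀ x ∈ Specht F μ, Etot F μ.parts x = a • x := by
  have hst : ∀ x ∈ Specht F μ, Etot F μ.parts x ∈ Specht F μ := by
    intro x hx
    rw [Etot_apply]
    exact Submodule.sum_mem _ fun g _ => Specht_perm g hx
  obtain ⟨a, ha⟩ := schur_Specht h2 μ ((Etot F μ.parts).restrict hst) (by
    intro π x y hxy
    rw [LinearMap.coe_restrict_apply, LinearMap.coe_restrict_apply, hxy, Etot_perm])
  exact ⟨a, fun x hx => congrArg Subtype.val (ha ⟨x, hx⟩)⟩

lemma resE_apply (hn : 0 < n) (μ : Partition n) (v : PermMod F n μ.parts) :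
    resE F hn μ v + LS F μ.parts ⟨n - 1, by omega⟩ v = Etot F μ.parts v := by
  rw [Etot_apply, sum_swaps (⟨n - 1, by omega⟩ : Fin n), LS_apply, resE, LinearMap.sum_apply]

lemma resE_stable (hn : 0 < n) (μ : Partition n) :
    ∀ x ∈ Specht F μ, resE F hn μ x ∈ Specht F μ := by
  intro x hx
  rw [resE, LinearMap.sum_apply]
  exact Submodule.sum_mem _ fun g _ => Specht_perm g hx

lemma resE_mem (hn : 0 < n) (μ : Partition n)
    (hst : ∀ x ∈ Specht F μ, resE F hn μ x ∈ Specht F μ) :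
    (resE F hn μ).restrict hst ∈ EndResAt F μ ⟨n - 1, by omega⟩ := by
  classical
  intro π hπ x y hxy
  rw [LinearMap.coe_restrict_apply, LinearMap.coe_restrict_apply, hxy]
  rw [resE, LinearMap.sum_apply, LinearMap.sum_apply, map_sum]
  symm
  have hπ' : π.symm ⟨n - 1, by omega⟩ = ⟨n - 1, by omega⟩ := by
    rw [Equiv.symm_apply_eq, hπ]
  apply Finset.sum_equiv (MulAut.conj π).toEquiv
  · intro g
    rw [Finset.mem_filter, Finset.mem_filter]
    simp only [Finset.mem_univ, true_and]
    refine and_congr (IsSwap_conj π g).symm ?_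
    show _ ↔ π (g (π.symm _)) = _
    rw [hπ', ← Equiv.eq_symm_apply π, hπ']
  · intro g _
    rw [← permM_mul_apply, ← permM_mul_apply]
    congr 2
    simp

lemma aeval_CX {V : Type*} [AddCommGroup V] [Module F V] (T : Module.End F V) (a : F) (v : V) :
    Polynomial.aeval T (Polynomial.C a - Polynomial.X) v = a • v - T v := by
  simp

theorem res_gen (h2 : (2 : F) ≠ 0) (hn : 0 < n) (μ : Partition n)
    (hst : ∀ x ∈ Specht F μ, resE F hn μ x ∈ Specht F μ)
    (Φ : Module.End F ↥(Specht F μ)) (hΦ : Φ ∈ EndResAt F μ ⟨n - 1, by omega⟩) :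
    ∃ q : Polynomial F, Φ = Polynomial.aeval ((resE F hn μ).restrict hst) q := by
  obtain ⟨a, ha⟩ := Etot_scalar h2 μ
  obtain ⟨p, hp⟩ := res_Specht h2 μ _ Φ hΦ
  set R : Module.End F ↥(Specht F μ) := (resE F hn μ).restrict hst with hR
  refine ⟨p.comp (Polynomial.C a - Polynomial.X), ?_⟩
  apply LinearMap.ext
  intro x
  apply Subtype.ext
  rw [hp, Polynomial.aeval_comp]
  symm
  refine aeval_comm (V := ↥(Specht F μ)) (S := ⊤) (W := PermMod F n μ.parts) (f := (Specht F μ).subtype)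
    (fun _ _ => Submodule.mem_top) (fun v _ => ?_) p Submodule.mem_top
  have h1 := resE_apply hn μ (v : PermMod F n μ.parts)
  rw [ha _ v.2] at h1
  have h3 := congrArg Subtype.val (aeval_CX R a v)
  refine h3.trans ?_
  show a • (v : PermMod F n μ.parts) - resE F hn μ v = _
  rw [← h1]
  simp

lemma adjoin_top {R A : Type*} [CommSemiring R] [Semiring A] [Algebra R A] (S : Subalgebra R A) (x : A)
    (hx : x ∈ S) (h : ∀ y ∈ S, ∃ q : Polynomial R, y = Polynomial.aeval x q) :
    Algebra.adjoin R {(⟨x, hx⟩ : S)} = ⊤ := by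
  rw [eq_top_iff]
  rintro ⟨y, hy⟩ -
  obtain ⟨q, hq⟩ := h y hy
  have h1 : (⟨y, hy⟩ : S) = Polynomial.aeval (⟨x, hx⟩ : S) q := by
    apply Subtype.ext
    have := Polynomial.aeval_algHom_apply S.val (⟨x, hx⟩ : S) q
    simp only [Subalgebra.coe_val] at this
    rw [← this]
    exact hq
  rw [h1]
  exact Polynomial.aeval_mem_adjoin_singleton R _

end Final1

open Finset
set_option linter.unusedSectionVars false

section Final2

variable {F : Type*} [Field F] {n : ℕ}

lemma incl_castSucc (h : Equiv.Perm (Fin n)) (k : Fin n) :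
    permIncl n h k.castSucc = (h k).castSucc :=
  Equiv.Perm.extendDomain_apply_image h (castE n) k

lemma incl_last (h : Equiv.Perm (Fin n)) : permIncl n h (Fin.last n) = Fin.last n :=
  Equiv.Perm.extendDomain_apply_not_subtype h (castE n) (by simp)

lemma incl_inj {h h' : Equiv.Perm (Fin n)} (hh : permIncl n h = permIncl n h') : h = h' := by
  ext k : 1
  apply Fin.castSucc_injective
  rw [← incl_castSucc, ← incl_castSucc, hh]

lemma exists_incl {g : Equiv.Perm (Fin (n + 1))} (hg : g (Fin.last n) = Fin.last n) :
    ∃ h, permIncl n h = g := by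
  have h1 : ∀ k : Fin n, ∃ j : Fin n, j.castSucc = g k.castSucc := by
    intro k
    rw [Fin.exists_castSucc_eq]
    intro h
    rw [← hg] at h
    exact (Fin.castSucc_lt_last k).ne (g.injective h)
  choose f hf using h1
  have hinj : Function.Injective f := by
    intro a b hab
    apply Fin.castSucc_injective
    apply g.injective
    rw [← hf, ← hf, hab]
  refine ⟨Equiv.ofBijective f (Finite.injective_iff_bijective.mp hinj), ?_⟩
  ext x : 1
  induction x using Fin.lastCases with
  | last => rw [incl_last, hg]
  | cast k => rw [incl_castSucc, ← hf]; rfl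

lemma incl_swap (a b : Fin n) :
    permIncl n (Equiv.swap a b) = Equiv.swap a.castSucc b.castSucc := by
  ext x : 1
  induction x using Fin.lastCases with
  | last =>
    rw [incl_last, Equiv.swap_apply_of_ne_of_ne (Fin.castSucc_lt_last a).ne'
      (Fin.castSucc_lt_last b).ne']
  | cast k =>
    rw [incl_castSucc, Equiv.swap_apply_def, Equiv.swap_apply_def]
    simp only [Fin.castSucc_inj]
    split_ifs <;> rfl

lemma incl_isSwap (h : Equiv.Perm (Fin n)) : (permIncl n h).IsSwap ↔ h.IsSwap := by
  constructor
  · rintro ⟨x, y, hxy, hh⟩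
    have hl := incl_last h
    rw [hh] at hl
    induction x using Fin.lastCases with
    | last =>
      rw [Equiv.swap_apply_left] at hl
      exact absurd hl.symm hxy
    | cast a =>
      induction y using Fin.lastCases with
      | last =>
        rw [Equiv.swap_apply_right] at hl
        exact absurd hl hxy
      | cast b =>
        rw [← incl_swap] at hh
        exact ⟨a, b, fun hab => hxy (by rw [hab]), incl_inj hh⟩
  · rintro ⟨x, y, hxy, rfl⟩
    exact ⟨_, _, fun h => hxy (Fin.castSucc_injective _ h), incl_swap x y⟩

open Classical in
/-- Sum over all transpositions in `Σ_{n+1}`. -/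
lemma sum_swaps_succ {V : Type*} [AddCommMonoid V] (f : Equiv.Perm (Fin (n + 1)) → V) :
    ∑ g ∈ univ.filter (fun g : Equiv.Perm (Fin (n + 1)) => g.IsSwap), f g
      = ∑ h ∈ univ.filter (fun g : Equiv.Perm (Fin n) => g.IsSwap), f (permIncl n h)
        + ∑ k : Fin n, f (Equiv.swap k.castSucc (Fin.last n)) := by
  rw [sum_swaps (Fin.last n)]
  congr 1
  · symm
    apply Finset.sum_bij (fun h _ => permIncl n h)
    · intro h hh
      rw [Finset.mem_filter] at hh ⊢
      exact ⟨Finset.mem_univ _, (incl_isSwap h).mpr hh.2, incl_last h⟩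
    · intro a _ b _ hab
      exact incl_inj hab
    · intro g hg
      rw [Finset.mem_filter] at hg
      obtain ⟨h, rfl⟩ := exists_incl hg.2.2
      exact ⟨h, Finset.mem_filter.mpr ⟨Finset.mem_univ _, (incl_isSwap h).mp hg.2.1⟩, rfl⟩
    · intro _ _
      rfl
  · symm
    apply Finset.sum_bij (fun k _ => Fin.castSucc k)
    · intro k _
      exact Finset.mem_erase.mpr ⟨(Fin.castSucc_lt_last k).ne, Finset.mem_univ _⟩
    · intro a _ b _ hab
      exact Fin.castSucc_injective _ hab
    · intro x hx
      obtain ⟨k, hk⟩ := Fin.exists_castSucc_eq.mpr (Finset.ne_of_mem_erase hx)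
      exact ⟨k, Finset.mem_univ _, hk⟩
    · intro _ _
      rfl

variable {μ : Partition n}

lemma ind_ext {x y : ↥(indSpecht F μ)} (h : ∀ σ, x.1 σ = y.1 σ) : x = y :=
  Subtype.ext (funext h)

open Classical in
/-- Embedding of the Specht module in the induced module. -/
noncomputable def iota (F : Type*) [Field F] (μ : Partition n) :
    ↥(Specht F μ) →ₗ[F] ↥(indSpecht F μ) where
  toFun v := ⟨fun g => if hg : g (Fin.last n) = Fin.last n then
      permM F μ.parts (exists_incl hg).choose⁻¹ (v : PermMod F n μ.parts) else 0, by
    constructor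
    · intro σ
      beta_reduce
      by_cases hg : σ (Fin.last n) = Fin.last n
      · rw [dif_pos hg]
        exact Specht_perm _ v.2
      · rw [dif_neg hg]
        exact Submodule.zero_mem _
    · intro σ h
      beta_reduce
      by_cases hg : σ (Fin.last n) = Fin.last n
      · have hg' : (σ * permIncl n h) (Fin.last n) = Fin.last n := by
          rw [Equiv.Perm.mul_apply, incl_last, hg]
        rw [dif_pos hg, dif_pos hg', ← permM_mul_apply, ← mul_inv_rev]
        congr 3
        apply incl_inj
        rw [(exists_incl hg').choose_spec, map_mul, (exists_incl hg).choose_spec]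
      · have hg' : ¬ (σ * permIncl n h) (Fin.last n) = Fin.last n := by
          rw [Equiv.Perm.mul_apply, incl_last]
          exact hg
        rw [dif_neg hg, dif_neg hg', map_zero]⟩
  map_add' u v := by
    apply ind_ext
    intro g
    by_cases hg : g (Fin.last n) = Fin.last n
    · simp [hg]
    · simp [hg]
  map_smul' r v := by
    apply ind_ext
    intro g
    by_cases hg : g (Fin.last n) = Fin.last n
    · simp [hg]
    · simp [hg]

lemma iota_incl (v : ↥(Specht F μ)) (h : Equiv.Perm (Fin n)) :
    (iota F μ v).1 (permIncl n h) = permM F μ.parts h⁻¹ (v : PermMod F n μ.parts) := by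
  have hg := incl_last h
  have : (iota F μ v).1 (permIncl n h)
      = permM F μ.parts (exists_incl hg).choose⁻¹ (v : PermMod F n μ.parts) := dif_pos hg
  rw [this]
  congr 3
  exact incl_inj (exists_incl hg).choose_spec

lemma iota_one (v : ↥(Specht F μ)) : (iota F μ v).1 1 = v := by
  have := iota_incl v 1
  rw [map_one, inv_one, permM_one_apply] at this
  exact this

lemma iota_not (v : ↥(Specht F μ)) {g : Equiv.Perm (Fin (n + 1))}
    (hg : g (Fin.last n) ≠ Fin.last n) : (iota F μ v).1 g = 0 := dif_neg hg

/-- The action on the Specht module. -/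
noncomputable def spAct (μ : Partition n) (h : Equiv.Perm (Fin n)) (v : ↥(Specht F μ)) :
    ↥(Specht F μ) := ⟨permM F μ.parts h v, Specht_perm h v.2⟩

lemma iota_act (v : ↥(Specht F μ)) (h : Equiv.Perm (Fin n)) :
    iota F μ (spAct μ h v) = indTrans F μ (permIncl n h) (iota F μ v) := by
  apply ind_ext
  intro σ
  show _ = (iota F μ v).1 ((permIncl n h)⁻¹ * σ)
  by_cases hg : σ (Fin.last n) = Fin.last n
  · obtain ⟨k, rfl⟩ := exists_incl hg
    rw [iota_incl, ← map_inv, ← map_mul, iota_incl, mul_inv_rev, inv_inv, permM_mul_apply]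
    rfl
  · rw [iota_not _ hg, iota_not]
    rw [← map_inv, Equiv.Perm.mul_apply]
    intro h'
    apply hg
    have := congrArg (permIncl n h) h'
    rw [incl_last, ← Equiv.Perm.mul_apply, ← map_mul, mul_inv_cancel, map_one] at this
    exact this

lemma ind_decomp (f : ↥(indSpecht F μ)) :
    f = ∑ k : Fin (n + 1), indTrans F μ (Equiv.swap k (Fin.last n))
      (iota F μ ⟨f.1 (Equiv.swap k (Fin.last n)), f.2.1 _⟩) := by
  apply ind_ext
  intro g
  rw [Submodule.coe_sum, Finset.sum_apply, Finset.sum_eq_single (g (Fin.last n))]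
  · show _ = (iota F μ _).1 ((Equiv.swap (g (Fin.last n)) (Fin.last n))⁻¹ * g)
    have hg : ((Equiv.swap (g (Fin.last n)) (Fin.last n))⁻¹ * g) (Fin.last n) = Fin.last n := by
      rw [Equiv.swap_inv, Equiv.Perm.mul_apply, Equiv.swap_apply_left]
    obtain ⟨h, hh⟩ := exists_incl hg
    rw [← hh, iota_incl]
    show _ = permM F μ.parts h⁻¹ (f.1 _)
    rw [← f.2.2, hh, mul_inv_cancel_left]
  · intro k _ hk
    show (iota F μ _).1 ((Equiv.swap k (Fin.last n))⁻¹ * g) = 0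
    apply iota_not
    rw [Equiv.swap_inv, Equiv.Perm.mul_apply]
    intro h
    apply hk
    rw [Equiv.swap_apply_eq_iff, Equiv.swap_apply_right] at h
    exact h.symm
  · intro h
    exact absurd (Finset.mem_univ _) h

lemma EndInd_trans {Φ : Module.End F ↥(indSpecht F μ)} (hΦ : Φ ∈ EndInd F μ)
    (g : Equiv.Perm (Fin (n + 1))) (y : ↥(indSpecht F μ)) :
    Φ (indTrans F μ g y) = indTrans F μ g (Φ y) :=
  Subtype.ext (hΦ g _ y rfl)

/-- value of `Φ(ι(h v))`. -/
lemma Phi_act {Φ : Module.End F ↥(indSpecht F μ)} (hΦ : Φ ∈ EndInd F μ)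
    (h : Equiv.Perm (Fin n)) (v : ↥(Specht F μ)) (σ : Equiv.Perm (Fin (n + 1))) :
    (Φ (iota F μ (spAct μ h v))).1 σ = (Φ (iota F μ v)).1 (permIncl n h⁻¹ * σ) := by
  rw [iota_act, EndInd_trans hΦ, map_inv]
  rfl

lemma spAct_inv (h : Equiv.Perm (Fin n)) (v : ↥(Specht F μ)) :
    spAct μ h (spAct μ h⁻¹ v) = v := by
  apply Subtype.ext
  show permM F μ.parts h (permM F μ.parts h⁻¹ v) = v
  rw [← permM_mul_apply, mul_inv_cancel, permM_one_apply]

lemma Phi_zero {Φ : Module.End F ↥(indSpecht F μ)} (hΦ : Φ ∈ EndInd F μ) (e : Fin n)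
    (h0 : ∀ v, (Φ (iota F μ v)).1 1 = 0)
    (hs : ∀ v, (Φ (iota F μ v)).1 (Equiv.swap e.castSucc (Fin.last n)) = 0) : Φ = 0 := by
  have h1 : ∀ v, Φ (iota F μ v) = 0 := by
    intro v
    rw [ind_decomp (Φ (iota F μ v))]
    apply Finset.sum_eq_zero
    intro k _
    have hz : (Φ (iota F μ v)).1 (Equiv.swap k (Fin.last n)) = 0 := by
      induction k using Fin.lastCases with
      | last =>
        rw [Equiv.swap_self]
        exact h0 v
      | cast k =>
        have h3 : Equiv.swap k.castSucc (Fin.last n)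
            = permIncl n (Equiv.swap e k) * Equiv.swap e.castSucc (Fin.last n)
              * permIncl n (Equiv.swap e k)⁻¹ := by
          rw [map_inv, ← Equiv.swap_apply_apply, incl_castSucc, incl_last, Equiv.swap_apply_left]
        have h4 := Phi_act hΦ (Equiv.swap e k)⁻¹ v (Equiv.swap e.castSucc (Fin.last n))
        rw [hs, inv_inv] at h4
        rw [h3, (Φ (iota F μ v)).2.2, ← h4, map_zero]
    have h5 : (⟨(Φ (iota F μ v)).1 (Equiv.swap k (Fin.last n)), (Φ (iota F μ v)).2.1 _⟩ :
        ↥(Specht F μ)) = 0 := Subtype.ext hz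
    rw [h5, map_zero, map_zero]
  apply LinearMap.ext
  intro f
  rw [ind_decomp f, map_sum]
  rw [LinearMap.zero_apply]
  apply Finset.sum_eq_zero
  intro k _
  rw [EndInd_trans hΦ, h1, map_zero]

/-- Evaluation of `Φ ∘ ι` at a group element, as an endomorphism of the Specht module. -/
noncomputable def DE (Φ : Module.End F ↥(indSpecht F μ)) (σ : Equiv.Perm (Fin (n + 1))) :
    Module.End F ↥(Specht F μ) where
  toFun v := ⟨(Φ (iota F μ v)).1 σ, (Φ (iota F μ v)).2.1 σ⟩
  map_add' u v := by
    apply Subtype.ext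
    simp
  map_smul' r v := by
    apply Subtype.ext
    simp

lemma DE_val (Φ : Module.End F ↥(indSpecht F μ)) (σ : Equiv.Perm (Fin (n + 1)))
    (v : ↥(Specht F μ)) : (DE Φ σ v : PermMod F n μ.parts) = (Φ (iota F μ v)).1 σ := rfl

lemma DE_one_scalar (h2 : (2 : F) ≠ 0) {Φ : Module.End F ↥(indSpecht F μ)}
    (hΦ : Φ ∈ EndInd F μ) : ∃ a : F, ∀ v : ↥(Specht F μ), DE Φ 1 v = a • v := by
  apply schur_Specht h2
  intro π x y hxy
  have hx : x = spAct μ π y := Subtype.ext hxy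
  rw [hx, DE_val, DE_val, Phi_act hΦ, mul_one, ← one_mul (permIncl n π⁻¹), (Φ _).2.2, inv_inv]

lemma DE_swap_mem {Φ : Module.End F ↥(indSpecht F μ)} (hΦ : Φ ∈ EndInd F μ) (e : Fin n) :
    DE Φ (Equiv.swap e.castSucc (Fin.last n)) ∈ EndResAt F μ e := by
  intro π hπ x y hxy
  have hx : x = spAct μ π y := Subtype.ext hxy
  have hc : permIncl n π⁻¹ * Equiv.swap e.castSucc (Fin.last n)
      = Equiv.swap e.castSucc (Fin.last n) * permIncl n π⁻¹ := by
    have hπ' : π⁻¹ e = e := by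
      rw [Equiv.Perm.inv_eq_iff_eq, hπ]
    have := Equiv.swap_apply_apply (permIncl n π⁻¹) e.castSucc (Fin.last n)
    rw [incl_castSucc, incl_last, hπ'] at this
    rw [eq_mul_inv_iff_mul_eq] at this
    exact this.symm
  rw [hx, DE_val, DE_val, Phi_act hΦ, hc, (Φ _).2.2, inv_inv]

open Classical in
lemma indE_apply (f : ↥(indSpecht F μ)) (σ : Equiv.Perm (Fin (n + 1))) :
    (indE F μ f).1 σ
      = ∑ g ∈ univ.filter (fun g : Equiv.Perm (Fin (n + 1)) => g.IsSwap), f.1 (σ * g) := by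
  rw [indE, LinearMap.sum_apply, Submodule.coe_sum, Finset.sum_apply]
  apply Finset.sum_equiv (MulAut.conj σ⁻¹).toEquiv
  · intro g
    rw [Finset.mem_filter, Finset.mem_filter]
    simp only [Finset.mem_univ, true_and]
    exact (IsSwap_conj σ⁻¹ g).symm
  · intro g hg
    rw [Finset.mem_filter] at hg
    obtain ⟨_, x, y, hxy, rfl⟩ := hg
    show f.1 ((Equiv.swap x y)⁻¹ * σ) = f.1 (σ * (σ⁻¹ * Equiv.swap x y * σ⁻¹⁻¹))
    rw [Equiv.swap_inv, inv_inv, mul_assoc, mul_inv_cancel_left]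

lemma indE_mem (F : Type*) [Field F] (μ : Partition n) : indE F μ ∈ EndInd F μ := by
  intro g x y hxy
  funext σ
  rw [indE_apply, indE_apply]
  apply Finset.sum_congr rfl
  intro h _
  rw [hxy]
  simp only [mul_assoc]

/-- Key recursion. -/
lemma DE_E (hn : 0 < n) {Φ : Module.End F ↥(indSpecht F μ)} (hΦ : Φ ∈ EndInd F μ)
    {ε a : F} (hε : ∀ x ∈ Specht F μ, Etot F μ.parts x = ε • x)
    (ha : ∀ v : ↥(Specht F μ), DE Φ 1 v = a • v) (e : Fin n) (v : ↥(Specht F μ)) :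
    (DE (indE F μ * Φ) (Equiv.swap e.castSucc (Fin.last n)) v : PermMod F n μ.parts)
      = ε • (DE Φ (Equiv.swap e.castSucc (Fin.last n)) v : PermMod F n μ.parts)
        + (a • (v : PermMod F n μ.parts)
        + ∑ k ∈ univ.erase e, (DE Φ (Equiv.swap e.castSucc (Fin.last n))
            (spAct μ (Equiv.swap k e) v) : PermMod F n μ.parts)) := by
  classical
  rw [DE_val, Module.End.mul_apply, indE_apply, sum_swaps_succ]
  congr 1
  · rw [DE_val, ← hε _ ((Φ (iota F μ v)).2.1 _), Etot_apply]
    apply Finset.sum_congr rfl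
    intro h hh
    rw [Finset.mem_filter] at hh
    obtain ⟨_, x, y, hxy, rfl⟩ := hh
    rw [(Φ (iota F μ v)).2.2, Equiv.swap_inv]
  · rw [← Finset.add_sum_erase _ _ (Finset.mem_univ e)]
    congr 1
    · rw [Equiv.swap_mul_self]
      exact congrArg Subtype.val (ha v)
    · apply Finset.sum_congr rfl
      intro k hk
      have hke : k ≠ e := Finset.ne_of_mem_erase hk
      rw [DE_val, Phi_act hΦ]
      have h1 := Equiv.swap_apply_apply (Equiv.swap e.castSucc (Fin.last n)) k.castSucc (Fin.last n)
      rw [Equiv.swap_apply_right, Equiv.swap_apply_of_ne_of_ne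
        (fun h => hke (Fin.castSucc_injective _ h)) (Fin.castSucc_lt_last k).ne] at h1
      rw [Equiv.swap_inv, incl_swap, h1, inv_mul_cancel_right]

end Final2

open Finset
set_option linter.unusedSectionVars false

section Final3

variable {F : Type*} [Field F] {n : ℕ} {μ : Partition n}

lemma DE_add (Φ Ψ : Module.End F ↥(indSpecht F μ)) (σ : Equiv.Perm (Fin (n + 1))) :
    DE (Φ + Ψ) σ = DE Φ σ + DE Ψ σ := rfl

lemma DE_smul (r : F) (Φ : Module.End F ↥(indSpecht F μ)) (σ : Equiv.Perm (Fin (n + 1))) :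
    DE (r • Φ) σ = r • DE Φ σ := rfl

lemma DE_id_one : DE (1 : Module.End F ↥(indSpecht F μ)) 1 = 1 := by
  apply LinearMap.ext
  intro v
  apply Subtype.ext
  exact iota_one v

lemma DE_id_swap (e : Fin n) :
    DE (1 : Module.End F ↥(indSpecht F μ)) (Equiv.swap e.castSucc (Fin.last n)) = 0 := by
  apply LinearMap.ext
  intro v
  apply Subtype.ext
  apply iota_not
  rw [Equiv.swap_apply_right]
  exact (Fin.castSucc_lt_last e).ne

/-- Key recursion in polynomial form. -/
lemma DE_E_poly (hn : 0 < n) (hst : ∀ x ∈ Specht F μ, resE F hn μ x ∈ Specht F μ)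
    {Φ : Module.End F ↥(indSpecht F μ)} (hΦ : Φ ∈ EndInd F μ)
    {ε a : F} (hε : ∀ x ∈ Specht F μ, Etot F μ.parts x = ε • x)
    (ha : ∀ v : ↥(Specht F μ), DE Φ 1 v = a • v)
    {s : Equiv.Perm (Fin (n + 1))}
    (hs : s = Equiv.swap (⟨n - 1, by omega⟩ : Fin n).castSucc (Fin.last n)) :
    DE (indE F μ * Φ) s + DE Φ s * (resE F hn μ).restrict hst
      = (2 * ε) • DE Φ s + a • (1 : Module.End F ↥(Specht F μ)) := by
  subst hs
  set e : Fin n := ⟨n - 1, by omega⟩ with he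
  set D := DE Φ (Equiv.swap e.castSucc (Fin.last n)) with hD
  apply LinearMap.ext
  intro v
  apply Subtype.ext
  have h1 : (∑ k ∈ univ.erase e, spAct μ (Equiv.swap k e) v)
      + (resE F hn μ).restrict hst v = ε • v := by
    apply Subtype.ext
    rw [Submodule.coe_add, Submodule.coe_sum]
    have h3 := resE_apply hn μ (v : PermMod F n μ.parts)
    rw [hε _ v.2, LS_apply] at h3
    show _ + resE F hn μ v = ε • (v : PermMod F n μ.parts)
    rw [← h3, add_comm]
    rfl
  have h4 : (∑ k ∈ univ.erase e, (D (spAct μ (Equiv.swap k e) v) : PermMod F n μ.parts))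
      = ε • (D v : PermMod F n μ.parts) - D ((resE F hn μ).restrict hst v) := by
    have h5 := congrArg Subtype.val (congrArg D h1)
    rw [map_add, map_sum, map_smul, Submodule.coe_add, Submodule.coe_sum] at h5
    rw [eq_sub_iff_add_eq]
    exact h5
  show (DE (indE F μ * Φ) (Equiv.swap e.castSucc (Fin.last n)) v : PermMod F n μ.parts)
    + (D ((resE F hn μ).restrict hst v) : PermMod F n μ.parts)
    = (2 * ε) • (D v : PermMod F n μ.parts) + a • (v : PermMod F n μ.parts)
  rw [DE_E hn hΦ hε ha e v, ← hD, h4]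
  rw [two_mul, add_smul]
  abel

lemma aeval_indE_mem (Q : Polynomial F) : Polynomial.aeval (indE F μ) Q ∈ EndInd F μ := by
  have h1 : Algebra.adjoin F {indE F μ} ≤ EndInd F μ := by
    apply Algebra.adjoin_le
    rw [Set.singleton_subset_iff]
    exact indE_mem F μ
  exact h1 (Polynomial.aeval_mem_adjoin_singleton F _)

lemma aeval_step {A : Type*} [Semiring A] [Algebra F A] (T : A) (a b c : F) (Q : Polynomial F) :
    Polynomial.aeval T (Polynomial.C a * Q + Polynomial.C c * (Polynomial.X * Q)
      + Polynomial.C b * Polynomial.X)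
      = a • Polynomial.aeval T Q + c • (T * Polynomial.aeval T Q) + b • T := by
  simp [Algebra.smul_def]

lemma aeval_addC {A : Type*} [Semiring A] [Algebra F A] (T : A) (a : F) (Q : Polynomial F) :
    Polynomial.aeval T (Q + Polynomial.C a) = Polynomial.aeval T Q + a • 1 := by
  simp [Algebra.smul_def]

lemma aeval_CmulX {A : Type*} [Semiring A] [Algebra F A] (T : A) (a : F) :
    Polynomial.aeval T (Polynomial.C a * Polynomial.X) = a • T := by
  simp [Algebra.smul_def]

lemma aeval_monoS {A : Type*} [Semiring A] [Algebra F A] (T : A) (a : F) (k : ℕ) :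
    Polynomial.aeval T (Polynomial.C a * Polynomial.X ^ (k + 1))
      = Polynomial.aeval T (Polynomial.C a * Polynomial.X ^ k) * T := by
  simp [pow_succ, mul_assoc]

lemma aeval_CC {A : Type*} [Semiring A] [Algebra F A] (T : A) (a : F) :
    Polynomial.aeval T (Polynomial.C a) = a • 1 := by
  simp [Algebra.smul_def]

lemma DE_surj (h2 : (2 : F) ≠ 0) (hn : 0 < n)
    (hst : ∀ x ∈ Specht F μ, resE F hn μ x ∈ Specht F μ)
    {s : Equiv.Perm (Fin (n + 1))}
    (hs : s = Equiv.swap (⟨n - 1, by omega⟩ : Fin n).castSucc (Fin.last n)) (q : Polynomial F) :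
    ∃ Q : Polynomial F, DE (Polynomial.aeval (indE F μ) Q) s
      = Polynomial.aeval ((resE F hn μ).restrict hst) q := by
  obtain ⟨ε, hε⟩ := Etot_scalar h2 μ
  have hE : DE (indE F μ) s = 1 := by
    have h1 := DE_E_poly hn hst (Φ := 1) (Subalgebra.one_mem _) (a := 1) hε
      (fun v => by rw [DE_id_one, one_smul]; rfl) hs
    have h3 : DE (1 : Module.End F ↥(indSpecht F μ)) s = 0 := by rw [hs, DE_id_swap]
    rw [h3, mul_one, zero_mul, add_zero, smul_zero, zero_add, one_smul] at h1
    exact h1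
  induction q using Polynomial.induction_on with
  | C c =>
    refine ⟨Polynomial.C c * Polynomial.X, ?_⟩
    rw [aeval_CmulX, DE_smul, hE, aeval_CC]
  | add p q hp hq =>
    obtain ⟨P, hP⟩ := hp
    obtain ⟨Q, hQ⟩ := hq
    exact ⟨P + Q, by rw [map_add, DE_add, hP, hQ, map_add]⟩
  | monomial k c ih =>
    obtain ⟨Q, hQ⟩ := ih
    obtain ⟨b, hb⟩ := DE_one_scalar h2 (aeval_indE_mem (μ := μ) Q)
    refine ⟨Polynomial.C (2 * ε) * Q + Polynomial.C (-1) * (Polynomial.X * Q)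
      + Polynomial.C b * Polynomial.X, ?_⟩
    have h1 := DE_E_poly hn hst (aeval_indE_mem (μ := μ) Q) hε hb hs
    rw [aeval_step, DE_add, DE_add, DE_smul, DE_smul, DE_smul, hE, aeval_monoS, ← hQ]
    apply LinearMap.ext
    intro v
    apply Subtype.ext
    have h3 := congrArg Subtype.val (LinearMap.congr_fun h1 v)
    generalize DE (Polynomial.aeval (indE F μ) Q) s = D at *
    generalize DE (indE F μ * Polynomial.aeval (indE F μ) Q) s = D' at *
    change (D' v : PermMod F n μ.parts) + (D ((resE F hn μ).restrict hst v) : PermMod F n μ.parts)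
      = (2 * ε) • (D v : PermMod F n μ.parts) + b • (v : PermMod F n μ.parts) at h3
    show (2 * ε) • (D v : PermMod F n μ.parts) + (-1 : F) • (D' v : PermMod F n μ.parts)
      + b • (v : PermMod F n μ.parts) = (D ((resE F hn μ).restrict hst v) : PermMod F n μ.parts)
    rw [add_right_comm, ← h3, neg_one_smul]
    abel

theorem ind_gen (h2 : (2 : F) ≠ 0) (hn : 0 < n)
    (Φ : Module.End F ↥(indSpecht F μ)) (hΦ : Φ ∈ EndInd F μ) :
    ∃ Q : Polynomial F, Φ = Polynomial.aeval (indE F μ) Q := by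
  have hst := resE_stable (F := F) hn μ
  obtain ⟨q, hq⟩ := res_gen h2 hn μ hst _ (DE_swap_mem hΦ _)
  obtain ⟨Q, hQ⟩ := DE_surj (μ := μ) h2 hn hst rfl q
  obtain ⟨a, ha⟩ := DE_one_scalar h2 hΦ
  obtain ⟨b, hb⟩ := DE_one_scalar h2 (aeval_indE_mem (μ := μ) Q)
  have hmem : Φ + (-1 : F) • Polynomial.aeval (indE F μ) Q + (b - a) • 1 ∈ EndInd F μ :=
    Subalgebra.add_mem _ (Subalgebra.add_mem _ hΦ (Subalgebra.smul_mem _ (aeval_indE_mem Q) _))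
      (Subalgebra.smul_mem _ (Subalgebra.one_mem _) _)
  have hz := Phi_zero hmem ⟨n - 1, by omega⟩ (fun v => by
      rw [← DE_val, DE_add, DE_add, DE_smul, DE_smul, DE_id_one]
      have ha' := congrArg Subtype.val (ha v)
      have hb' := congrArg Subtype.val (hb v)
      show (DE Φ 1 v : PermMod F n μ.parts)
        + (-1 : F) • (DE (Polynomial.aeval (indE F μ) Q) 1 v : PermMod F n μ.parts)
        + (b - a) • (v : PermMod F n μ.parts) = 0
      rw [ha', hb']
      show a • (v : PermMod F n μ.parts) + (-1 : F) • (b • (v : PermMod F n μ.parts))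
        + (b - a) • (v : PermMod F n μ.parts) = 0
      rw [smul_smul, ← add_smul, ← add_smul]
      have : a + -1 * b + (b - a) = 0 := by ring
      rw [this, zero_smul]) (fun v => by
      rw [← DE_val, DE_add, DE_add, DE_smul, DE_smul, DE_id_swap, hq, hQ]
      generalize Polynomial.aeval ((resE F hn μ).restrict hst) q = D
      show (D v : PermMod F n μ.parts) + (-1 : F) • (D v : PermMod F n μ.parts)
        + (b - a) • (0 : PermMod F n μ.parts) = 0
      rw [smul_zero, add_zero, neg_one_smul, add_neg_cancel])
  refine ⟨Q + Polynomial.C (a - b), ?_⟩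
  rw [aeval_addC]
  apply LinearMap.ext
  intro x
  apply ind_ext
  intro σ
  have h1 := congrFun (congrArg Subtype.val (LinearMap.congr_fun hz x)) σ
  generalize Polynomial.aeval (indE F μ) Q = E at *
  change (Φ x).1 σ + (-1 : F) • (E x).1 σ + (b - a) • x.1 σ = 0 at h1
  show (Φ x).1 σ = (E x).1 σ + (a - b) • x.1 σ
  rw [← sub_eq_zero, ← h1, neg_one_smul, sub_smul, sub_smul]
  abel

lemma two_ne (F : Type*) [Field F] (p : ℕ) [CharP F p] (hp : p ≠ 2) : (2 : F) ≠ 0 := by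
  intro h
  have h1 : ((2 : ℕ) : F) = 0 := by exact_mod_cast h
  rw [CharP.cast_eq_zero_iff F p] at h1
  rcases (Nat.dvd_prime Nat.prime_two).mp h1 with h3 | h3
  · exact CharP.char_ne_one F p h3
  · exact hp h3

end Final3

/-- Let `F` be a field of characteristic `p ≠ 2` and `λ` a partition of
`n` (`n ≥ 1`).  Then the image of `E_{n+1}` under the structural map
`FΣ_{n+1} → End_F(S^λ↑^{Σ_{n+1}})` generates `End_{FΣ_{n+1}}(S^λ↑^{Σ_{n+1}})` as an
`F`-algebra, and the image of `E_{n-1}` under `FΣ_{n-1} → End_F(S^λ↓_{Σ_{n-1}})`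
(the sum of the transpositions fixing the last symbol, which maps the Specht submodule
to itself) generates `End_{FΣ_{n-1}}(S^λ↓_{Σ_{n-1}})` as an `F`-algebra. -/
theorem stmt6 (F : Type*) [Field F] (p : ℕ) [CharP F p] (hp : p ≠ 2)
    {n : ℕ} (hn : 0 < n) (lam : Partition n) :
    (∃ hmem : indE F lam ∈ EndInd F lam,
      Algebra.adjoin F {(⟨indE F lam, hmem⟩ : ↥(EndInd F lam))} = ⊤) ∧
    (∃ (hst : ∀ x ∈ Specht F lam, resE F hn lam x ∈ Specht F lam)
        (hmem : (resE F hn lam).restrict hst ∈ EndResAt F lam ⟨n - 1, by omega⟩),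
      Algebra.adjoin F
        {(⟨(resE F hn lam).restrict hst, hmem⟩ : ↥(EndResAt F lam ⟨n - 1, by omega⟩))} = ⊤) := by
  have h2 := two_ne F p hp
  refine ⟨⟨indE_mem F lam, adjoin_top _ _ _ fun Φ hΦ => ind_gen h2 hn Φ hΦ⟩,
    resE_stable hn lam, resE_mem hn lam _, adjoin_top _ _ _ fun Φ hΦ => ?_⟩
  exact res_gen h2 hn lam _ Φ hΦ

end CarterPayne
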